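/- Let p, r : [0,1] → ℝ be continuous with p(x) > 0 and r(x) > 0 for all x ∈ [0,1], and let c, α ∈ ℝ. Define: λ is the n-th negative eigenvalue (in decreasing order) of a boundary-value problem if λ < 0, λ is an eigenvalue of the problem, and the set of eigenvalues μ of the problem with λ < μ < 0 has exactly n − 1 elements. Then: (a) if λ is the n-th negative eigenvalue of the problem (E_T) with boundary conditions (BC1) and λ' is the n-th negative eigenvalue of (E_T) with boundary conditions (BC2), then λ < λ'; (b) if λ is the n-th negative eigenvalue of (E_T) with (BC1) and ν is the (n+1)-th negative eigenvalue of (E_T) with (BC2), then ν < λ; (c) if c > 0 and α ≥ 0, λ₁ > 0 is an eigenvalue of (E_T) with (BC1) having no eigenvalue of that problem in (0,λ₁), and λ'₁ > 0 is an eigenvalue of (E_T) with (BC2) having no eigenvalue of that problem in (0,λ'₁), then λ'₁ < λ₁. -/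

import Mathlib

open Set

/-- Derivative within the interval `[0,1]`. -/
noncomputable def Dv (y : ℝ → ℝ) : ℝ → ℝ := derivWithin y (Set.Icc 0 1)

/-- `y` is not identically zero on `[0,1]`. -/
def Nontriv (y : ℝ → ℝ) : Prop := ∃ x ∈ Set.Icc (0:ℝ) 1, y x ≠ 0

/-- `y` is a classical solution of `(p y'')'' - lam * (-y'' + c r y) = 0` on `[0,1]`. -/
def SolT (p r : ℝ → ℝ) (c lam : ℝ) (y : ℝ → ℝ) : Prop :=
  ContDiffOn ℝ 2 y (Set.Icc 0 1) ∧
  ContDiffOn ℝ 2 (fun x => p x * Dv (Dv y) x) (Set.Icc 0 1) ∧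
  ∀ x ∈ Set.Icc (0:ℝ) 1,
    Dv (Dv (fun t => p t * Dv (Dv y) t)) x
      - lam * (-(Dv (Dv y) x) + c * r x * y x) = 0

/-- Clamped boundary conditions `y(0) = y'(0) = y(1) = y'(1) = 0`. -/
def BC1 (y : ℝ → ℝ) : Prop := y 0 = 0 ∧ Dv y 0 = 0 ∧ y 1 = 0 ∧ Dv y 1 = 0

/-- Boundary conditions `y(0) = y'(0) = y'(1) = 0`, `(p y'')'(1) + lam * alpha * y(1) = 0`. -/
def BC2 (p : ℝ → ℝ) (lam alpha : ℝ) (y : ℝ → ℝ) : Prop :=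
  y 0 = 0 ∧ Dv y 0 = 0 ∧ Dv y 1 = 0 ∧
  Dv (fun t => p t * Dv (Dv y) t) 1 + lam * alpha * y 1 = 0

/-- Linear dependence of two functions on `[0,1]`. -/
def LinDep (y₁ y₂ : ℝ → ℝ) : Prop :=
  ∃ a b : ℝ, (a ≠ 0 ∨ b ≠ 0) ∧ ∀ x ∈ Set.Icc (0:ℝ) 1, a * y₁ x + b * y₂ x = 0

/-- `lam` is an eigenvalue of the problem (E_T), (BC1). -/
def EigT1 (p r : ℝ → ℝ) (c lam : ℝ) : Prop :=
  ∃ y : ℝ → ℝ, SolT p r c lam y ∧ Nontriv y ∧ BC1 y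

/-- `lam` is an eigenvalue of the problem (E_T), (BC2). -/
def EigT2 (p r : ℝ → ℝ) (c alpha lam : ℝ) : Prop :=
  ∃ y : ℝ → ℝ, SolT p r c lam y ∧ Nontriv y ∧ BC2 p lam alpha y

/-- `lam` is the `n`-th negative eigenvalue (in decreasing order) of the problem whose
eigenvalues are described by the predicate `E`. -/
def NthNegEig (E : ℝ → Prop) (n : ℕ) (lam : ℝ) : Prop :=
  lam < 0 ∧ E lam ∧ {μ : ℝ | E μ ∧ lam < μ ∧ μ < 0}.Finite ∧
    {μ : ℝ | E μ ∧ lam < μ ∧ μ < 0}.ncard = n - 1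

open Filter Topology MeasureTheory


theorem ev_of_neg {E : Type*} [NormedAddCommGroup E] [InnerProductSpace ℝ E] [CompleteSpace E]
    (T : E →L[ℝ] E) (hc : IsCompactOperator T) (hs : ∀ x y, inner ℝ (T x) y = inner ℝ x (T y))
    (μ : ℝ) (hμ : μ < 0) (w : E) (hw : w ≠ 0) (hneg : inner ℝ (T w) w ≤ μ * ‖w‖ ^ 2) :
    ∃ g : E, g ≠ 0 ∧ ∃ ν ≤ μ, T g = ν • g := by
  set R : Set ℝ := {a | ∃ x : E, ‖x‖ = 1 ∧ inner ℝ (T x) x = a} with hR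
  have hwn : 0 < ‖w‖ := norm_pos_iff.2 hw
  have hR1 : inner ℝ (T ((‖w‖⁻¹) • w)) ((‖w‖⁻¹) • w) ∈ R := by
    refine ⟨(‖w‖⁻¹) • w, ?_, rfl⟩
    rw [norm_smul, norm_inv, norm_norm, inv_mul_cancel₀ hwn.ne']
  have hbdd : BddBelow R := by
    refine ⟨-‖T‖, ?_⟩
    rintro a ⟨x, hx, rfl⟩
    have h1 := abs_real_inner_le_norm (T x) x
    have h2 := T.le_opNorm x
    rw [hx] at h1 h2
    have := neg_abs_le (inner ℝ (T x) x)
    linarith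
  set m := sInf R with hm
  have hmμ : m ≤ μ := by
    refine (csInf_le hbdd hR1).trans ?_
    rw [map_smul, real_inner_smul_left, real_inner_smul_right]
    have : ‖w‖⁻¹ * (‖w‖⁻¹ * inner ℝ (T w) w) ≤ ‖w‖⁻¹ * (‖w‖⁻¹ * (μ * ‖w‖ ^ 2)) := by
      gcongr
    refine this.trans (le_of_eq ?_)
    field_simp
  have hm0 : m < 0 := hmμ.trans_lt hμ
  obtain ⟨a, -, ha, haR⟩ := exists_seq_tendsto_sInf ⟨_, hR1⟩ hbdd
  choose x hx1 hxa using haR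
  set A : E →L[ℝ] E := T - m • ContinuousLinearMap.id ℝ E with hA
  have hAx : ∀ v, A v = T v - m • v := fun v => by simp [hA]
  have hApos : ∀ v, 0 ≤ inner ℝ (A v) v := by
    intro v
    rcases eq_or_ne v 0 with rfl | hv
    · simp
    have hvn : 0 < ‖v‖ := norm_pos_iff.2 hv
    have : inner ℝ (T ((‖v‖⁻¹) • v)) ((‖v‖⁻¹) • v) ∈ R := by
      refine ⟨(‖v‖⁻¹) • v, ?_, rfl⟩
      rw [norm_smul, norm_inv, norm_norm, inv_mul_cancel₀ hvn.ne']
    have h := csInf_le hbdd this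
    rw [map_smul, real_inner_smul_left, real_inner_smul_right] at h
    rw [hAx, inner_sub_left, real_inner_smul_left, real_inner_self_eq_norm_sq]
    have h2 : m * ‖v‖ ^ 2 ≤ ‖v‖⁻¹ * (‖v‖⁻¹ * inner ℝ (T v) v) * ‖v‖ ^ 2 := by
      gcongr
    have h3 : ‖v‖⁻¹ * (‖v‖⁻¹ * inner ℝ (T v) v) * ‖v‖ ^ 2 = inner ℝ (T v) v := by
      field_simp
    linarith
  have hAs : ∀ u v, inner ℝ (A u) v = inner ℝ u (A v) := by
    intro u v
    simp only [hAx, inner_sub_left, inner_sub_right, real_inner_smul_left, real_inner_smul_right, hs]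
  set M := ‖A‖ + 1 with hM
  have hMpos : 0 < M := by positivity
  have hCS : ∀ v, ‖A v‖ ^ 2 ≤ M * inner ℝ (A v) v := by
    intro v
    have h := hApos (v - M⁻¹ • A v)
    have e : inner ℝ (A (v - M⁻¹ • A v)) (v - M⁻¹ • A v)
        = inner ℝ (A v) v - 2 * M⁻¹ * ‖A v‖ ^ 2 + M⁻¹ ^ 2 * inner ℝ (A (A v)) (A v) := by
      simp only [map_sub, map_smul, inner_sub_left, inner_sub_right, real_inner_smul_left,
        real_inner_smul_right]
      rw [hAs (A v) v, real_inner_self_eq_norm_sq]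
      ring
    rw [e] at h
    have h2 : inner ℝ (A (A v)) (A v) ≤ M * ‖A v‖ ^ 2 := by
      have h3 := real_inner_le_norm (A (A v)) (A v)
      have h4 := A.le_opNorm (A v)
      nlinarith [norm_nonneg (A v)]
    have h5 : M⁻¹ ^ 2 * inner ℝ (A (A v)) (A v) ≤ M⁻¹ ^ 2 * (M * ‖A v‖ ^ 2) := by gcongr
    have h6 : M⁻¹ ^ 2 * (M * ‖A v‖ ^ 2) = M⁻¹ * ‖A v‖ ^ 2 := by field_simp
    have h7 : M⁻¹ * ‖A v‖ ^ 2 ≤ inner ℝ (A v) v := by linarith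
    calc ‖A v‖ ^ 2 = M * (M⁻¹ * ‖A v‖ ^ 2) := by field_simp
      _ ≤ _ := by gcongr
  have hAn : Tendsto (fun n => A (x n)) atTop (𝓝 0) := by
    rw [tendsto_zero_iff_norm_tendsto_zero]
    have h1 : Tendsto (fun n => M * (a n - m)) atTop (𝓝 0) := by
      have := (ha.sub_const m).const_mul M
      rwa [← hm, sub_self, mul_zero] at this
    have h2 : Tendsto (fun n => ‖A (x n)‖ ^ 2) atTop (𝓝 0) := by
      refine squeeze_zero (fun n => by positivity) (fun n => ?_) h1
      refine (hCS (x n)).trans (le_of_eq ?_)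
      rw [hAx, inner_sub_left, real_inner_smul_left, real_inner_self_eq_norm_sq, hx1, hxa]
      ring
    have h3 := (Real.continuous_sqrt.tendsto 0).comp h2
    simpa [Function.comp_def, Real.sqrt_sq] using h3
  obtain ⟨C, hC, hsub⟩ := hc.image_closedBall_subset_compact (𝕜₁ := ℝ) (f := (T : E →ₗ[ℝ] E)) 1
  have hTC : ∀ n, T (x n) ∈ C := fun n => hsub ⟨x n, by simp [hx1], rfl⟩
  obtain ⟨z, -, φ, hφ, hz⟩ := hC.tendsto_subseq hTC
  have hxlim : Tendsto (fun n => x (φ n)) atTop (𝓝 (m⁻¹ • z)) := by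
    have h1 := (hz.sub (hAn.comp hφ.tendsto_atTop)).const_smul m⁻¹
    simp only [sub_zero] at h1
    refine h1.congr (fun n => ?_)
    simp only [Function.comp, hAx, sub_sub_cancel, smul_smul, inv_mul_cancel₀ hm0.ne, one_smul]
  refine ⟨m⁻¹ • z, ?_, m, hmμ, ?_⟩
  · have h1 : Tendsto (fun n => ‖x (φ n)‖) atTop (𝓝 ‖m⁻¹ • z‖) := hxlim.norm
    simp only [hx1] at h1
    have := tendsto_nhds_unique h1 tendsto_const_nhds
    rw [← norm_ne_zero_iff, this]; exact one_ne_zero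
  · have h1 : Tendsto (fun n => A (x (φ n))) atTop (𝓝 (A (m⁻¹ • z))) :=
      (A.continuous.tendsto _).comp hxlim
    have h2 := tendsto_nhds_unique h1 (hAn.comp hφ.tendsto_atTop)
    rw [hAx, sub_eq_zero] at h2
    exact h2

theorem ev_sub {H : Type*} [NormedAddCommGroup H] [InnerProductSpace ℝ H] [CompleteSpace H]
    (K : H →L[ℝ] H) (hc : IsCompactOperator K) (hs : ∀ x y, inner ℝ (K x) y = inner ℝ x (K y))
    (W : Submodule ℝ H) (hW : IsClosed (W : Set H))
    (μ : ℝ) (hμ : μ < 0) (w : H) (hwW : w ∈ W) (hw : w ≠ 0)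
    (hneg : inner ℝ (K w) w ≤ μ * ‖w‖ ^ 2) :
    ∃ g ∈ W, g ≠ 0 ∧ ∃ ν ≤ μ, ∀ v ∈ W, inner ℝ (K g) v = ν * inner ℝ g v := by
  have : CompleteSpace W := hW.completeSpace_coe
  set T : W →L[ℝ] W := W.orthogonalProjectionOnto ∘L K ∘L W.subtypeL with hT
  have hin : ∀ a b : W, inner ℝ (T a) b = inner ℝ (K a) (b : H) := by
    intro a b
    simp [hT]
  have hTc : IsCompactOperator T := by
    have h1 := (hc.comp_clm W.subtypeL).clm_comp W.orthogonalProjectionOnto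
    exact h1
  obtain ⟨g, hg, ν, hν, hgν⟩ := ev_of_neg T hTc (fun a b => by
    rw [hin, hs, real_inner_comm (T b), hin, real_inner_comm]
    ) μ hμ ⟨w, hwW⟩ (by simpa [Subtype.ext_iff] using hw) (by rw [hin]; simpa using hneg)
  refine ⟨g, g.2, by simpa using hg, ν, hν, fun v hv => ?_⟩
  have := hin g ⟨v, hv⟩
  rw [hgν, real_inner_smul_left] at this
  simpa using this.symm

def IsEV {H : Type*} [NormedAddCommGroup H] [InnerProductSpace ℝ H]
    (K : H →L[ℝ] H) (V : Submodule ℝ H) (μ : ℝ) (g : H) : Prop :=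
  g ∈ V ∧ g ≠ 0 ∧ ∀ v ∈ V, inner ℝ (K g) v = μ * inner ℝ g v

theorem count_lemma {H : Type*} [NormedAddCommGroup H] [InnerProductSpace ℝ H] [CompleteSpace H]
    (K : H →L[ℝ] H) (hc : IsCompactOperator K) (hs : ∀ x y, inner ℝ (K x) y = inner ℝ x (K y))
    (V V' : Submodule ℝ H) (hV : IsClosed (V : Set H)) (μ : ℝ) (hμ : μ < 0)
    (S T : Finset ℝ) (hS : ∀ ν ≤ μ, ∀ g, IsEV K V ν g → ν ∈ S)
    (hsimple : ∀ ν ≤ μ, ∀ g g', IsEV K V ν g → IsEV K V ν g' → inner ℝ g g' ≠ 0)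
    (hT : ∀ t ∈ T, t ≤ μ ∧ ∃ f, IsEV K V' t f)
    (k : ℕ) (ψ : Fin k → H) (hψ : ∀ g ∈ V', (∀ i, inner ℝ (ψ i) g = 0) → g ∈ V)
    (hcard : S.card + k < T.card) : False := by
  classical
  choose! hTμ f hf using hT
  set e : ℝ → H := fun ν => if h : ∃ g, IsEV K V ν g then h.choose else 0 with he
  have heEV : ∀ ν g, IsEV K V ν g → IsEV K V ν (e ν) := by
    intro ν g hg
    have h : ∃ g, IsEV K V ν g := ⟨g, hg⟩
    simp only [he, dif_pos h]; exact h.choose_spec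
  have hemem : ∀ ν, e ν ∈ V := by
    intro ν
    by_cases h : ∃ g, IsEV K V ν g
    · exact (heEV ν _ h.choose_spec).1
    · simp [he, dif_neg h]
  have heq : ∀ ν, ∀ v ∈ V, inner ℝ (K (e ν)) v = ν * inner ℝ (e ν) v := by
    intro ν
    by_cases h : ∃ g, IsEV K V ν g
    · exact (heEV ν _ h.choose_spec).2.2
    · simp [he, dif_neg h]
  have horth : ∀ s ∈ T, ∀ t ∈ T, s ≠ t → inner ℝ (f s) (f t) = 0 := by
    intro s hsT t htT hst
    have h1 := (hf s hsT).2.2 (f t) (hf t htT).1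
    have h2 := (hf t htT).2.2 (f s) (hf s hsT).1
    rw [hs, real_inner_comm] at h1
    rw [h1, real_inner_comm (f s) (f t)] at h2
    have : (s - t) * inner ℝ (f s) (f t) = 0 := by linarith
    rcases mul_eq_zero.1 this with h | h
    · exact absurd (sub_eq_zero.1 h) hst
    · exact h
  let comb : (T → ℝ) →ₗ[ℝ] H := ∑ t : T, (LinearMap.proj t).smulRight (f t)
  have hcomb : ∀ a : T → ℝ, comb a = ∑ t : T, a t • f t := by
    intro a; simp [comb]
  let L : (T → ℝ) →ₗ[ℝ] ((S → ℝ) × (Fin k → ℝ)) :=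
    LinearMap.prod (LinearMap.pi fun s : S => (innerSL ℝ (e s) : H →ₗ[ℝ] ℝ) ∘ₗ comb)
      (LinearMap.pi fun i => (innerSL ℝ (ψ i) : H →ₗ[ℝ] ℝ) ∘ₗ comb)
  have hker : LinearMap.ker L ≠ ⊥ := by
    apply LinearMap.ker_ne_bot_of_finrank_lt
    simpa using hcard
  obtain ⟨a, haL, ha0⟩ := (Submodule.ne_bot_iff _).1 hker
  rw [LinearMap.mem_ker] at haL
  have hL1 : ∀ s ∈ S, inner ℝ (e s) (comb a) = 0 := by
    intro s hs'
    have := congrFun (congrArg Prod.fst haL) ⟨s, hs'⟩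
    simpa [L] using this
  have hL2 : ∀ i, inner ℝ (ψ i) (comb a) = 0 := by
    intro i
    have := congrFun (congrArg Prod.snd haL) i
    simpa [L] using this
  have hfin : ∀ t : T, ∀ b : T → ℝ, inner ℝ (f t) (∑ s : T, b s • f s) = b t * ‖f t‖ ^ 2 := by
    intro t b
    rw [inner_sum, Finset.sum_eq_single t]
    · rw [real_inner_smul_right, real_inner_self_eq_norm_sq]
    · intro s _ hst
      rw [real_inner_smul_right, horth t t.2 s s.2 (fun h => hst (Subtype.ext h.symm)), mul_zero]
    · simp
  have hwV' : comb a ∈ V' := by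
    rw [hcomb]
    exact V'.sum_mem fun t _ => V'.smul_mem _ (hf t t.2).1
  have hw0 : comb a ≠ 0 := by
    intro h
    apply ha0
    funext t
    have h1 := hfin t a
    rw [← hcomb, h, inner_zero_right] at h1
    have h2 : ‖f t‖ ^ 2 ≠ 0 := by
      have := (hf t t.2).2.1
      positivity
    rcases mul_eq_zero.1 h1.symm with h3 | h3
    · simpa using h3
    · exact absurd h3 h2
  have hneg : inner ℝ (K (comb a)) (comb a) ≤ μ * ‖comb a‖ ^ 2 := by
    have h1 : inner ℝ (K (comb a)) (comb a) = ∑ t : T, (t : ℝ) * (a t ^ 2 * ‖f t‖ ^ 2) := by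
      have : K (comb a) = ∑ t : T, a t • K (f t) := by rw [hcomb, map_sum]; simp
      rw [this, sum_inner]
      refine Finset.sum_congr rfl fun t _ => ?_
      rw [real_inner_smul_left, (hf t t.2).2.2 _ hwV', hcomb, hfin]
      ring
    have h2 : ‖comb a‖ ^ 2 = ∑ t : T, (a t ^ 2 * ‖f t‖ ^ 2) := by
      rw [← real_inner_self_eq_norm_sq]
      conv_lhs => rw [hcomb]
      rw [sum_inner]
      refine Finset.sum_congr rfl fun t _ => ?_
      rw [real_inner_smul_left, hfin]
      ring
    rw [h1, h2, Finset.mul_sum]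
    refine Finset.sum_le_sum fun t _ => ?_
    have := hTμ t t.2
    gcongr
  set N : Submodule ℝ H := Submodule.span ℝ ((S.image e : Finset H) : Set H) with hN
  have : FiniteDimensional ℝ N := FiniteDimensional.span_finset ℝ _
  have hNperp : ∀ v, (∀ s ∈ S, inner ℝ (e s) v = 0) → ∀ n ∈ N, inner ℝ n v = 0 := by
    intro v hv n hn
    have : N ≤ (ℝ ∙ v)ᗮ := by
      rw [hN, Submodule.span_le]
      intro b hb
      simp only [Finset.coe_image, Set.mem_image, Finset.mem_coe] at hb
      obtain ⟨s, hsS, rfl⟩ := hb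
      rw [SetLike.mem_coe, Submodule.mem_orthogonal_singleton_iff_inner_left]
      exact hv s hsS
    exact (Submodule.mem_orthogonal_singleton_iff_inner_left).1 (this hn)
  have heN : ∀ s ∈ S, e s ∈ N := fun s hsS =>
    Submodule.subset_span (by simpa using ⟨s, hsS, rfl⟩)
  have hNV : N ≤ V := by
    rw [hN, Submodule.span_le]
    intro b hb
    simp only [Finset.coe_image, Set.mem_image, Finset.mem_coe] at hb
    obtain ⟨s, hsS, rfl⟩ := hb
    exact hemem s
  obtain ⟨g, hgW, hg0, ν, hν, hgv⟩ := ev_sub K hc hs (V ⊓ Nᗮ)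
    (by rw [Submodule.coe_inf]; exact hV.inter (Submodule.isClosed_orthogonal N)) μ hμ (comb a)
    ⟨hψ _ hwV' hL2, (Submodule.mem_orthogonal _ _).2 (hNperp _ hL1)⟩ hw0 hneg
  have hgV := hgW.1
  have hgN : ∀ n ∈ N, inner ℝ n g = 0 := (Submodule.mem_orthogonal _ _).1 hgW.2
  have hEV : IsEV K V ν g := by
    refine ⟨hgV, hg0, fun v hv => ?_⟩
    have hdec : v = N.starProjection v + (v - N.starProjection v) := by abel
    have hn : N.starProjection v ∈ N := Submodule.starProjection_apply_mem _ _
    have h1 := hgv (v - N.starProjection v)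
      ⟨V.sub_mem hv (hNV hn), Submodule.sub_starProjection_mem_orthogonal v⟩
    have h2 : inner ℝ (N.starProjection v) (K g) = 0 := by
      refine hNperp (K g) (fun s hsS => ?_) _ hn
      rw [← hs, heq s g hgV, hgN _ (heN s hsS), mul_zero]
    have h3 := hgN _ hn
    rw [inner_sub_right, inner_sub_right, real_inner_comm (N.starProjection v) (K g), h2,
      real_inner_comm (N.starProjection v) g, h3] at h1
    linarith
  have hνS := hS ν hν g hEV
  exact hsimple ν hν _ _ (heEV ν g hEV) hEV (hgN _ (heN ν hνS))

theorem mono_aux {F f : ℝ → ℝ} (h : ∀ x ∈ Icc (0:ℝ) 1, HasDerivWithinAt F (f x) (Icc 0 1) x)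
    {a b : ℝ} (ha : 0 ≤ a) (hab : a ≤ b) (hb : b ≤ 1) (hf : ∀ x ∈ Ioo a b, 0 ≤ f x) :
    F a ≤ F b := by
  have hsub : Icc a b ⊆ Icc (0:ℝ) 1 := Icc_subset_Icc ha hb
  have hd : ∀ x ∈ Ioo a b, HasDerivAt F (f x) x := fun x hx =>
    (h x (hsub (Ioo_subset_Icc_self hx))).hasDerivAt
      (Icc_mem_nhds (ha.trans_lt hx.1) (hx.2.trans_le hb))
  have : MonotoneOn F (Icc a b) := by
    apply monotoneOn_of_deriv_nonneg (convex_Icc a b)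
    · exact fun x hx => ((h x (hsub hx)).continuousWithinAt).mono hsub
    · rw [interior_Icc]
      exact fun x hx => (hd x hx).differentiableAt.differentiableWithinAt
    · rw [interior_Icc]
      intro x hx
      rw [(hd x hx).deriv]; exact hf x hx
  exact this (left_mem_Icc.2 hab) (right_mem_Icc.2 hab) hab

def Coop (α β γ y u q z : ℝ → ℝ) : Prop :=
  ∀ x ∈ Icc (0:ℝ) 1, HasDerivWithinAt y (u x) (Icc 0 1) x ∧
    HasDerivWithinAt u (α x * q x) (Icc 0 1) x ∧
    HasDerivWithinAt q (z x) (Icc 0 1) x ∧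
    HasDerivWithinAt z (β x * q x + γ x * y x) (Icc 0 1) x

theorem Coop.neg {α β γ y u q z : ℝ → ℝ} (h : Coop α β γ y u q z) :
    Coop α β γ (fun x => -y x) (fun x => -u x) (fun x => -q x) (fun x => -z x) := by
  intro x hx
  obtain ⟨h1, h2, h3, h4⟩ := h x hx
  refine ⟨h1.neg, ?_, h3.neg, ?_⟩
  · exact h2.neg.congr_deriv (by ring)
  · exact h4.neg.congr_deriv (by ring)

theorem Coop.rev {α β γ y u q z : ℝ → ℝ} (h : Coop α β γ y u q z) :
    Coop (fun x => α (1 - x)) (fun x => β (1 - x)) (fun x => γ (1 - x))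
      (fun x => y (1 - x)) (fun x => -u (1 - x)) (fun x => q (1 - x)) (fun x => -z (1 - x)) := by
  intro x hx
  have hx' : 1 - x ∈ Icc (0:ℝ) 1 := ⟨by linarith [hx.2], by linarith [hx.1]⟩
  have hm : MapsTo (fun x : ℝ => 1 - x) (Icc 0 1) (Icc 0 1) :=
    fun x hx => ⟨by linarith [hx.2], by linarith [hx.1]⟩
  have hd : HasDerivWithinAt (fun x : ℝ => 1 - x) (-1) (Icc 0 1) x := by
    simpa using (hasDerivWithinAt_id x (Icc (0:ℝ) 1)).const_sub 1
  obtain ⟨h1, h2, h3, h4⟩ := h (1 - x) hx'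
  refine ⟨?_, ?_, ?_, ?_⟩
  · exact (h1.scomp x hd hm).congr_deriv (by simp)
  · exact (h2.scomp x hd hm).neg.congr_deriv (by simp)
  · exact (h3.scomp x hd hm).congr_deriv (by simp)
  · exact (h4.scomp x hd hm).neg.congr_deriv (by simp)

theorem Coop.nonneg {α β γ y u q z : ℝ → ℝ} (h : Coop α β γ y u q z) {L : ℝ} (hL : 1 ≤ L)
    (hα : ∀ x ∈ Icc (0:ℝ) 1, 0 ≤ α x ∧ α x ≤ L) (hβ : ∀ x ∈ Icc (0:ℝ) 1, 0 ≤ β x)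
    (hγ : ∀ x ∈ Icc (0:ℝ) 1, 0 ≤ γ x) (hβγ : ∀ x ∈ Icc (0:ℝ) 1, β x + γ x ≤ L)
    (hy : 0 ≤ y 0) (hu : 0 ≤ u 0) (hq : 0 ≤ q 0) (hz : 0 ≤ z 0) :
    ∀ x ∈ Icc (0:ℝ) 1, 0 ≤ y x ∧ 0 ≤ u x ∧ 0 ≤ q x ∧ 0 ≤ z x := by
  have key : ∀ ε > 0, ∀ x ∈ Icc (0:ℝ) 1,
      0 < min (min (y x + ε * Real.exp (L * x)) (u x + ε * Real.exp (L * x)))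
        (min (q x + ε * Real.exp (L * x)) (z x + ε * Real.exp (L * x))) := by
    intro ε hε
    set E : ℝ → ℝ := fun x => ε * Real.exp (L * x) with hE
    have hEpos : ∀ x, 0 < E x := fun x => by positivity
    have hEd : ∀ x, HasDerivWithinAt E (L * E x) (Icc 0 1) x := by
      intro x
      have : HasDerivAt E (ε * (Real.exp (L * x) * (L * 1))) x :=
        (((hasDerivAt_id x).const_mul L).exp).const_mul ε
      exact this.hasDerivWithinAt.congr_deriv (by simp only [hE]; ring)
    set f : ℝ → ℝ := fun x => min (min (y x + E x) (u x + E x)) (min (q x + E x) (z x + E x)) with hf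
    have hEc : ContinuousOn E (Icc 0 1) := fun x _ => (hEd x).continuousWithinAt
    have hfc : ContinuousOn f (Icc 0 1) := by
      refine ContinuousOn.inf (ContinuousOn.inf ?_ ?_) (ContinuousOn.inf ?_ ?_) <;>
        refine ContinuousOn.add ?_ hEc
      · exact fun x hx => (h x hx).1.continuousWithinAt
      · exact fun x hx => (h x hx).2.1.continuousWithinAt
      · exact fun x hx => (h x hx).2.2.1.continuousWithinAt
      · exact fun x hx => (h x hx).2.2.2.continuousWithinAt
    change ∀ x ∈ Icc (0:ℝ) 1, 0 < f x
    by_contra hcon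
    push Not at hcon
    set B : Set ℝ := Icc 0 1 ∩ f ⁻¹' Iic 0 with hB
    have hBc : IsCompact B :=
      isCompact_Icc.of_isClosed_subset (hfc.preimage_isClosed_of_isClosed isClosed_Icc isClosed_Iic)
        inter_subset_left
    obtain ⟨x0, hx0, hfx0⟩ := hcon
    have htB := hBc.sInf_mem ⟨x0, hx0, hfx0⟩
    set t := sInf B
    have hlt : ∀ x ∈ Ioo 0 t, 0 < y x + E x ∧ 0 < u x + E x ∧ 0 < q x + E x ∧ 0 < z x + E x := by
      intro x hx
      have hxB : x ∉ B := fun hxB => absurd (csInf_le hBc.bddBelow hxB) (not_le.2 hx.2)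
      have hxf : 0 < f x := by
        by_contra hx'
        exact hxB ⟨⟨hx.1.le, hx.2.le.trans htB.1.2⟩, not_lt.1 hx'⟩
      simp only [hf, lt_min_iff] at hxf
      exact ⟨hxf.1.1, hxf.1.2, hxf.2.1, hxf.2.2⟩
    have hI : ∀ x ∈ Ioo 0 t, x ∈ Icc (0:ℝ) 1 := fun x hx => ⟨hx.1.le, hx.2.le.trans htB.1.2⟩
    have a1 := mono_aux (F := fun x => y x + E x) (fun x hx => (h x hx).1.add (hEd x)) le_rfl
      htB.1.1 htB.1.2 (fun x hx => by nlinarith [hlt x hx, hEpos x])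
    have a2 := mono_aux (F := fun x => u x + E x) (fun x hx => (h x hx).2.1.add (hEd x)) le_rfl
      htB.1.1 htB.1.2 (fun x hx => by
        have h1 := hα x (hI x hx)
        have h2 := mul_nonneg h1.1 (hlt x hx).2.2.1.le
        have h3 := mul_nonneg (sub_nonneg.2 h1.2) (hEpos x).le
        nlinarith)
    have a3 := mono_aux (F := fun x => q x + E x) (fun x hx => (h x hx).2.2.1.add (hEd x)) le_rfl
      htB.1.1 htB.1.2 (fun x hx => by nlinarith [hlt x hx, hEpos x])
    have a4 := mono_aux (F := fun x => z x + E x) (fun x hx => (h x hx).2.2.2.add (hEd x)) le_rfl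
      htB.1.1 htB.1.2 (fun x hx => by
        have h1 := mul_nonneg (hβ x (hI x hx)) (hlt x hx).2.2.1.le
        have h2 := mul_nonneg (hγ x (hI x hx)) (hlt x hx).1.le
        have h3 := mul_nonneg (sub_nonneg.2 (hβγ x (hI x hx))) (hEpos x).le
        nlinarith)
    have hft : f t ≤ 0 := htB.2
    have : 0 < f t := by
      simp only [hf, lt_min_iff]
      have := hEpos 0
      beta_reduce at a1 a2 a3 a4
      refine ⟨⟨?_, ?_⟩, ?_, ?_⟩ <;> linarith
    linarith
  intro x hx
  have key2 : ∀ δ > 0, 0 < min (min (y x + δ) (u x + δ)) (min (q x + δ) (z x + δ)) := by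
    intro δ hδ
    have := key (δ / Real.exp (L * x)) (by positivity) x hx
    rwa [div_mul_cancel₀ _ (Real.exp_pos _).ne'] at this
  simp only [lt_min_iff] at key2
  refine ⟨?_, ?_, ?_, ?_⟩ <;> refine le_of_forall_pos_le_add fun δ hδ => ?_
  · exact (key2 δ hδ).1.1.le
  · exact (key2 δ hδ).1.2.le
  · exact (key2 δ hδ).2.1.le
  · exact (key2 δ hδ).2.2.le

theorem Coop.zero_fwd {α β γ y u q z : ℝ → ℝ} (h : Coop α β γ y u q z) {L : ℝ} (hL : 1 ≤ L)
    (hα : ∀ x ∈ Icc (0:ℝ) 1, 0 ≤ α x ∧ α x ≤ L) (hβ : ∀ x ∈ Icc (0:ℝ) 1, 0 ≤ β x)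
    (hγ : ∀ x ∈ Icc (0:ℝ) 1, 0 ≤ γ x) (hβγ : ∀ x ∈ Icc (0:ℝ) 1, β x + γ x ≤ L)
    (hy : y 0 = 0) (hu : u 0 = 0) (hq : q 0 = 0) (hu1 : u 1 = 0) :
    ∀ x ∈ Icc (0:ℝ) 1, y x = 0 := by
  have main : ∀ y u q z : ℝ → ℝ, Coop α β γ y u q z → y 0 = 0 → u 0 = 0 → q 0 = 0 → u 1 = 0 →
      0 ≤ z 0 → ∀ x ∈ Icc (0:ℝ) 1, y x = 0 := by
    clear hy hu hq hu1 h y u q z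
    intro y u q z h hy hu hq hu1 hz x hx
    have hn := h.nonneg hL hα hβ hγ hβγ hy.ge hu.ge hq.ge hz
    have hu0 : ∀ x ∈ Icc (0:ℝ) 1, u x ≤ 0 := by
      intro x hx
      rw [← hu1]
      exact mono_aux (fun x hx => (h x hx).2.1) hx.1 hx.2 le_rfl fun t ht => by
        have htI : t ∈ Icc (0:ℝ) 1 := ⟨hx.1.trans ht.1.le, ht.2.le⟩
        exact mul_nonneg (hα t htI).1 (hn t htI).2.2.1
    have h1 := mono_aux (F := fun x => -y x) (fun x hx => (h x hx).1.neg) le_rfl hx.1 hx.2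
      (fun t ht => by
        have htI : t ∈ Icc (0:ℝ) 1 := ⟨ht.1.le, ht.2.le.trans hx.2⟩
        linarith [hu0 t htI])
    have := (hn x hx).1
    beta_reduce at h1
    linarith
  rcases le_total 0 (z 0) with hz | hz
  · exact main y u q z h hy hu hq hu1 hz
  · intro x hx
    have := main _ _ _ _ h.neg (by simp [hy]) (by simp [hu]) (by simp [hq]) (by simp [hu1])
      (by simpa using hz) x hx
    simpa using this

theorem Coop.zero_bwd {α β γ y u q z : ℝ → ℝ} (h : Coop α β γ y u q z) {L : ℝ} (hL : 1 ≤ L)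
    (hα : ∀ x ∈ Icc (0:ℝ) 1, 0 ≤ α x ∧ α x ≤ L) (hβ : ∀ x ∈ Icc (0:ℝ) 1, 0 ≤ β x)
    (hγ : ∀ x ∈ Icc (0:ℝ) 1, 0 ≤ γ x) (hβγ : ∀ x ∈ Icc (0:ℝ) 1, β x + γ x ≤ L)
    (hy0 : y 0 = 0) (hy : y 1 = 0) (hu : u 1 = 0) (hz : z 1 = 0) :
    ∀ x ∈ Icc (0:ℝ) 1, y x = 0 := by
  have hm : ∀ x ∈ Icc (0:ℝ) 1, 1 - x ∈ Icc (0:ℝ) 1 :=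
    fun x hx => ⟨by linarith [hx.2], by linarith [hx.1]⟩
  have main : ∀ y u q z : ℝ → ℝ, Coop α β γ y u q z → y 0 = 0 → y 1 = 0 → u 1 = 0 → z 1 = 0 →
      0 ≤ q 1 → ∀ x ∈ Icc (0:ℝ) 1, y x = 0 := by
    clear hy hu hy0 hz h y u q z
    intro y u q z h hy0 hy hu hz hq x hx
    have hn := h.rev.nonneg hL (fun x hx => hα _ (hm x hx)) (fun x hx => hβ _ (hm x hx))
      (fun x hx => hγ _ (hm x hx)) (fun x hx => hβγ _ (hm x hx)) (by simp [hy]) (by simp [hu])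
      (by simpa using hq) (by simp [hz])
    have h1 := hn (1 - x) (hm x hx)
    have h2 := mono_aux (F := fun x => -y x) (fun x hx => (h x hx).1.neg) le_rfl hx.1 hx.2
      (fun t ht => by
        have htI : t ∈ Icc (0:ℝ) 1 := ⟨ht.1.le, ht.2.le.trans hx.2⟩
        have := (hn (1 - t) (hm t htI)).2.1
        simpa using this)
    simp only [sub_sub_cancel] at h1 h2
    linarith [h1.1]
  rcases le_total 0 (q 1) with hq | hq
  · exact main y u q z h hy0 hy hu hz hq
  · intro x hx
    have := main _ _ _ _ h.neg (by simp [hy0]) (by simp [hy]) (by simp [hu]) (by simp [hz])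
      (by simpa using hq) x hx
    simpa using this

theorem exists_phi (P : ℝ → ℝ) (hP : Continuous P) (hm : Monotone P) (h0 : P 0 = 0) :
    ∃ φ : ℝ → Lp ℝ 2 (volume : Measure ℝ), Continuous φ ∧
      ∀ s ∈ Icc (0:ℝ) 1, ∀ x ∈ Icc (0:ℝ) 1, inner ℝ (φ s) (φ x) = P (min s x) := by
  let φ : ℝ → Lp ℝ 2 (volume : Measure ℝ) := fun s =>
    indicatorConstLp 2 (measurableSet_Ioc : MeasurableSet (Ioc 0 (P s))) (by simp) (1:ℝ)
  have hG : ∀ s x, inner ℝ (φ s) (φ x) = max (min (P s) (P x)) 0 := by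
    intro s x
    simp only [φ]
    rw [L2.inner_indicatorConstLp_one_indicatorConstLp_one _ _ (by simp) (by simp), Ioc_inter_Ioc]
    rw [Measure.real, Real.volume_Ioc, sup_idem, sub_zero, ENNReal.toReal_ofReal']
    rfl
  refine ⟨φ, ?_, ?_⟩
  · rw [continuous_iff_continuousAt]
    intro s
    rw [ContinuousAt, tendsto_iff_norm_sub_tendsto_zero]
    have h1 : ∀ x, ‖φ x - φ s‖ = Real.sqrt (max (min (P x) (P x)) 0 - 2 * max (min (P x) (P s)) 0
        + max (min (P s) (P s)) 0) := by
      intro x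
      rw [← hG, ← hG, ← hG, real_inner_self_eq_norm_sq, real_inner_self_eq_norm_sq,
        ← norm_sub_sq_real, Real.sqrt_sq (norm_nonneg _)]
    simp only [h1]
    have h2 : Continuous fun x => Real.sqrt (max (min (P x) (P x)) 0 - 2 * max (min (P x) (P s)) 0
        + max (min (P s) (P s)) 0) := by fun_prop
    have h3 := h2.tendsto s
    have h4 : max (min (P s) (P s)) 0 - 2 * max (min (P s) (P s)) 0
        + max (min (P s) (P s)) 0 = 0 := by ring
    rw [h4, Real.sqrt_zero] at h3
    exact h3
  · intro s hs x hx
    rw [hG, ← hm.map_min, max_eq_left]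
    rw [← h0]
    exact hm (le_min hs.1 hx.1)

set_option linter.unusedSectionVars false

section
variable {H : Type*} [NormedAddCommGroup H] [InnerProductSpace ℝ H] [CompleteSpace H]

structure KRep (p P : ℝ → ℝ) (φ : ℝ → H) : Prop where
  cont : Continuous φ
  gram : ∀ s ∈ Icc (0:ℝ) 1, ∀ x ∈ Icc (0:ℝ) 1, inner ℝ (φ s) (φ x) = P (min s x)
  Pd : ∀ x, HasDerivAt P (1 / p x) x
  P0 : P 0 = 0
  pc : Continuous p
  ppos : ∀ x, 0 < p x

noncomputable def R1 (a : H) : H →L[ℝ] H := (innerSL ℝ a).smulRight a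

theorem R1_apply (a g : H) : R1 a g = (inner ℝ a g : ℝ) • a := by simp [R1]

theorem R1_cont : Continuous (R1 : H → (H →L[ℝ] H)) := by
  unfold R1
  exact ((ContinuousLinearMap.smulRightL ℝ H H).continuous₂).comp
    ((innerSL ℝ).continuous.prodMk continuous_id)

theorem R1_compact (a : H) : IsCompactOperator (R1 a) := by
  have h : IsCompactOperator (innerSL ℝ a) :=
    isCompactOperator_of_locallyCompactSpace_dom (innerSL ℝ a)
  exact h.clm_comp ((ContinuousLinearMap.id ℝ ℝ).smulRight a)

noncomputable def phi2 (φ : ℝ → H) (x : ℝ) : H := ∫ t in (0:ℝ)..x, φ t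

noncomputable def Kop (φ : ℝ → H) (r : ℝ → ℝ) (c α : ℝ) : H →L[ℝ] H :=
  (∫ x in (0:ℝ)..1, R1 (φ x)) + c • (∫ x in (0:ℝ)..1, r x • R1 (phi2 φ x)) + α • R1 (phi2 φ 1)

theorem phi2_deriv {φ : ℝ → H} (hφ : Continuous φ) (x : ℝ) : HasDerivAt (phi2 φ) (φ x) x :=
  intervalIntegral.integral_hasDerivAt_right (hφ.intervalIntegrable _ _)
    (hφ.stronglyMeasurableAtFilter _ _) hφ.continuousAt

theorem phi2_cont {φ : ℝ → H} (hφ : Continuous φ) : Continuous (phi2 φ) :=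
  continuous_iff_continuousAt.2 fun x => (phi2_deriv hφ x).continuousAt

theorem phi2_zero (φ : ℝ → H) : phi2 φ 0 = 0 := by simp [phi2]

theorem inner_phi2_deriv {φ : ℝ → H} (hφ : Continuous φ) (v : H) (x : ℝ) :
    HasDerivAt (fun x => (inner ℝ (phi2 φ x) v : ℝ)) (inner ℝ (φ x) v) x := by
  have := (phi2_deriv hφ x).inner ℝ (hasDerivAt_const x v)
  simpa using this

theorem K_apply {φ : ℝ → H} (hφ : Continuous φ) {r : ℝ → ℝ} (hr : Continuous r) (c α : ℝ) (g : H) :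
    Kop φ r c α g = (∫ x in (0:ℝ)..1, (inner ℝ (φ x) g : ℝ) • φ x)
      + c • (∫ x in (0:ℝ)..1, (r x * inner ℝ (phi2 φ x) g : ℝ) • phi2 φ x)
      + (α * inner ℝ (phi2 φ 1) g : ℝ) • phi2 φ 1 := by
  have h2 := phi2_cont hφ
  have c1 : Continuous fun x => R1 (φ x) := R1_cont.comp hφ
  have c2 : Continuous fun x => r x • R1 (phi2 φ x) := hr.smul (R1_cont.comp h2)
  simp only [Kop, add_apply, smul_apply]
  rw [ContinuousLinearMap.intervalIntegral_apply (c1.intervalIntegrable _ _),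
    ContinuousLinearMap.intervalIntegral_apply (c2.intervalIntegrable _ _)]
  simp only [smul_apply, R1_apply, smul_smul]

theorem inner_int {f : ℝ → H} (hf : Continuous f) (v : H) (a b : ℝ) :
    inner ℝ (∫ x in a..b, f x) v = ∫ x in a..b, (inner ℝ (f x) v : ℝ) := by
  have := (innerSL ℝ v).intervalIntegral_comp_comm (hf.intervalIntegrable (μ := volume) a b)
  simp only [innerSL_apply_apply] at this
  rw [real_inner_comm, ← this]
  simp only [real_inner_comm]

theorem K_inner {φ : ℝ → H} (hφ : Continuous φ) {r : ℝ → ℝ} (hr : Continuous r) (c α : ℝ)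
    (g v : H) :
    inner ℝ (Kop φ r c α g) v = (∫ x in (0:ℝ)..1, (inner ℝ (φ x) g * inner ℝ (φ x) v : ℝ))
      + c * (∫ x in (0:ℝ)..1, (r x * inner ℝ (phi2 φ x) g * inner ℝ (phi2 φ x) v : ℝ))
      + α * inner ℝ (phi2 φ 1) g * inner ℝ (phi2 φ 1) v := by
  have h2 := phi2_cont hφ
  rw [K_apply hφ hr, inner_add_left, inner_add_left, real_inner_smul_left, real_inner_smul_left,
    inner_int (by fun_prop), inner_int (by fun_prop)]
  simp only [real_inner_smul_left]

theorem K_symm {φ : ℝ → H} (hφ : Continuous φ) {r : ℝ → ℝ} (hr : Continuous r) (c α : ℝ)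
    (g v : H) : inner ℝ (Kop φ r c α g) v = inner ℝ g (Kop φ r c α v) := by
  rw [real_inner_comm _ g, K_inner hφ hr, K_inner hφ hr]
  congr 1
  · congr 1
    · congr 1; ext x; ring
    · congr 2; ext x; ring
  · ring

theorem int_compact {F : ℝ → (H →L[ℝ] H)} (hF : Continuous F) (h : ∀ x, IsCompactOperator (F x)) :
    IsCompactOperator (∫ x in (0:ℝ)..1, F x : H →L[ℝ] H) := by
  rw [intervalIntegral.integral_of_le zero_le_one]
  have : IsProbabilityMeasure (volume.restrict (Ioc (0:ℝ) 1)) := ⟨by simp⟩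
  have := Convex.integral_mem (μ := volume.restrict (Ioc (0:ℝ) 1))
    (s := { f : H →L[ℝ] H | IsCompactOperator f }) (f := F)
    (compactOperator (RingHom.id ℝ) H H).convex isClosed_setOfPred_isCompactOperator
    (Filter.Eventually.of_forall h) (hF.integrableOn_Ioc)
  exact this

theorem K_compact {φ : ℝ → H} (hφ : Continuous φ) {r : ℝ → ℝ} (hr : Continuous r) (c α : ℝ) :
    IsCompactOperator (Kop φ r c α) := by
  have h2 := phi2_cont hφ
  have c1 : Continuous fun x => R1 (φ x) := R1_cont.comp hφ
  have c2 : Continuous fun x => r x • R1 (phi2 φ x) := hr.smul (R1_cont.comp h2)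
  exact ((int_compact c1 fun x => R1_compact _).add
    ((int_compact c2 fun x => (R1_compact _).smul (r x)).smul c)).add ((R1_compact _).smul α)

theorem ftc {F f : ℝ → ℝ} (h : ∀ x ∈ Icc (0:ℝ) 1, HasDerivWithinAt F (f x) (Icc 0 1) x)
    (hf : Continuous f) {s : ℝ} (hs : s ∈ Icc (0:ℝ) 1) : ∫ x in (0:ℝ)..s, f x = F s - F 0 := by
  have hsub : Icc 0 s ⊆ Icc (0:ℝ) 1 := Icc_subset_Icc le_rfl hs.2
  refine intervalIntegral.integral_eq_sub_of_hasDerivAt_of_le hs.1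
    (fun x hx => (h x (hsub hx)).continuousWithinAt.mono hsub) (fun x hx => ?_)
    (hf.intervalIntegrable _ _)
  exact (h x (hsub (Ioo_subset_Icc_self hx))).hasDerivAt
      (Icc_mem_nhds hx.1 (hx.2.trans_le hs.2))

theorem tail_deriv {m : ℝ → ℝ} (hm : Continuous m) (x : ℝ) :
    HasDerivAt (fun t => ∫ s in t..1, m s) (-m x) x :=
  intervalIntegral.integral_hasDerivAt_left (hm.intervalIntegrable _ _)
    (hm.stronglyMeasurableAtFilter _ _) hm.continuousAt

theorem tail_cont {m : ℝ → ℝ} (hm : Continuous m) : Continuous (fun t => ∫ s in t..1, m s) :=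
  continuous_iff_continuousAt.2 fun x => (tail_deriv hm x).continuousAt

theorem parts {φ : ℝ → H} (hφ : Continuous φ) {f : ℝ → ℝ} (hf : Continuous f) :
    ∫ x in (0:ℝ)..1, f x • phi2 φ x = ∫ x in (0:ℝ)..1, (∫ s in x..1, f s) • φ x := by
  have := intervalIntegral.integral_smul_deriv_eq_deriv_smul_of_hasDerivAt (a := 0) (b := 1)
    (u := fun x => ∫ s in x..1, f s) (v := phi2 φ) (u' := fun x => - f x) (v' := φ)
    (tail_cont hf).continuousOn (phi2_cont hφ).continuousOn (fun x _ => tail_deriv hf x)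
    (fun x _ => phi2_deriv hφ x) (hf.neg.intervalIntegrable _ _) (hφ.intervalIntegrable _ _)
  rw [this]
  simp [phi2_zero]

variable {p P : ℝ → ℝ} {φ : ℝ → H}

theorem KRep.Pc (h : KRep p P φ) : Continuous P :=
  continuous_iff_continuousAt.2 fun x => (h.Pd x).continuousAt

theorem KRep.phi_zero (h : KRep p P φ) : φ 0 = 0 := by
  have := h.gram 0 (by simp) 0 (by simp)
  rw [min_self, h.P0] at this
  exact inner_self_eq_zero.1 this

theorem KRep.key (h : KRep p P φ) {m : ℝ → ℝ} (hm : Continuous m) {s : ℝ} (hs : s ∈ Icc (0:ℝ) 1) :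
    inner ℝ (φ s) (∫ x in (0:ℝ)..1, m x • φ x) = ∫ t in (0:ℝ)..s, (∫ x in t..1, m x) / p t := by
  have hPc := h.Pc
  have hφ := h.cont
  rw [real_inner_comm, inner_int (by fun_prop)]
  have e1 : ∫ x in (0:ℝ)..1, (inner ℝ (m x • φ x) (φ s) : ℝ)
      = ∫ x in (0:ℝ)..1, m x * P (min s x) := by
    refine intervalIntegral.integral_congr fun x hx => ?_
    rw [uIcc_of_le zero_le_one] at hx
    simp only [real_inner_smul_left]
    rw [real_inner_comm, h.gram s hs x hx]
  have e2 : ∫ x in (0:ℝ)..1, m x * P (min s x)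
      = (∫ x in (0:ℝ)..s, m x * P x) + P s * ∫ x in s..1, m x := by
    have hc : Continuous fun x => m x * P (min s x) := by fun_prop
    rw [← intervalIntegral.integral_add_adjacent_intervals (b := s)
      (hc.intervalIntegrable _ _) (hc.intervalIntegrable _ _)]
    congr 1
    · refine intervalIntegral.integral_congr fun x hx => ?_
      rw [uIcc_of_le hs.1] at hx
      simp only [min_eq_right hx.2]
    · rw [← intervalIntegral.integral_const_mul]
      refine intervalIntegral.integral_congr fun x hx => ?_
      rw [uIcc_of_le hs.2] at hx
      simp only [min_eq_left hx.1]; ring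
  have hd : ∀ s, HasDerivAt (fun s => (∫ x in (0:ℝ)..s, m x * P x) + P s * ∫ x in s..1, m x)
      ((∫ x in s..1, m x) / p s) s := by
    intro s
    have hc : Continuous fun x => m x * P x := by fun_prop
    have h1 : HasDerivAt (fun s => ∫ x in (0:ℝ)..s, m x * P x) (m s * P s) s :=
      intervalIntegral.integral_hasDerivAt_right (hc.intervalIntegrable _ _)
        (hc.stronglyMeasurableAtFilter _ _) hc.continuousAt
    refine (h1.add ((h.Pd s).mul (tail_deriv hm s))).congr_deriv ?_
    ring
  have hcc : Continuous fun s => (∫ x in s..1, m x) / p s :=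
    (tail_cont hm).div h.pc fun x => (h.ppos x).ne'
  rw [e1, e2, intervalIntegral.integral_eq_sub_of_hasDerivAt (fun x _ => hd x)
    (hcc.intervalIntegrable _ _)]
  simp [h.P0]

end

def Sys (p r : ℝ → ℝ) (c lam : ℝ) (y u q z : ℝ → ℝ) : Prop :=
  (Continuous y ∧ Continuous u ∧ Continuous q ∧ Continuous z) ∧
  ∀ x ∈ Icc (0:ℝ) 1, HasDerivWithinAt y (u x) (Icc 0 1) x ∧
    HasDerivWithinAt u (q x / p x) (Icc 0 1) x ∧
    HasDerivWithinAt q (z x) (Icc 0 1) x ∧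
    HasDerivWithinAt z (lam * (-(q x / p x) + c * r x * y x)) (Icc 0 1) x

def SE1 (p r : ℝ → ℝ) (c lam : ℝ) : Prop :=
  ∃ y u q z, Sys p r c lam y u q z ∧ Nontriv y ∧ y 0 = 0 ∧ u 0 = 0 ∧ y 1 = 0 ∧ u 1 = 0

def SE2 (p r : ℝ → ℝ) (c α lam : ℝ) : Prop :=
  ∃ y u q z, Sys p r c lam y u q z ∧ Nontriv y ∧ y 0 = 0 ∧ u 0 = 0 ∧ u 1 = 0 ∧
    z 1 + lam * α * y 1 = 0

def clx (f : ℝ → ℝ) (x : ℝ) : ℝ := f (max 0 (min 1 x))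

theorem clx_mem (x : ℝ) : max 0 (min 1 x) ∈ Icc (0:ℝ) 1 :=
  ⟨le_max_left _ _, max_le zero_le_one (min_le_left _ _)⟩

theorem clx_eq (f : ℝ → ℝ) {x : ℝ} (hx : x ∈ Icc (0:ℝ) 1) : clx f x = f x := by
  simp [clx, min_eq_right hx.2, max_eq_right hx.1]

theorem clx_cont {f : ℝ → ℝ} (hf : ContinuousOn f (Icc 0 1)) : Continuous (clx f) :=
  hf.comp_continuous (by fun_prop) clx_mem

theorem clx_deriv {f : ℝ → ℝ} {d x : ℝ} (hx : x ∈ Icc (0:ℝ) 1)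
    (h : HasDerivWithinAt f d (Icc 0 1) x) : HasDerivWithinAt (clx f) d (Icc 0 1) x :=
  h.congr (fun _ hy => clx_eq f hy) (clx_eq f hx)

theorem Dv_eq {f f' : ℝ → ℝ} (h : ∀ x ∈ Icc (0:ℝ) 1, HasDerivWithinAt f (f' x) (Icc 0 1) x)
    {x : ℝ} (hx : x ∈ Icc (0:ℝ) 1) : Dv f x = f' x :=
  (h x hx).derivWithin (uniqueDiffOn_Icc_zero_one x hx)

theorem Dv_congr {f g : ℝ → ℝ} (h : ∀ x ∈ Icc (0:ℝ) 1, f x = g x)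
    {x : ℝ} (hx : x ∈ Icc (0:ℝ) 1) : Dv f x = Dv g x :=
  derivWithin_congr h (h x hx)

theorem cd2 {f f' f'' : ℝ → ℝ} (h : ∀ x ∈ Icc (0:ℝ) 1, HasDerivWithinAt f (f' x) (Icc 0 1) x)
    (h' : ∀ x ∈ Icc (0:ℝ) 1, HasDerivWithinAt f' (f'' x) (Icc 0 1) x)
    (hc : ContinuousOn f'' (Icc 0 1)) : ContDiffOn ℝ 2 f (Icc 0 1) := by
  have e : (2 : WithTop ℕ∞) = 1 + 1 := by norm_num
  have h1 : ContDiffOn ℝ 1 f' (Icc 0 1) := by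
    have e1 : (1 : WithTop ℕ∞) = 0 + 1 := by norm_num
    rw [e1, contDiffOn_succ_iff_derivWithin uniqueDiffOn_Icc_zero_one]
    refine ⟨fun x hx => (h' x hx).differentiableWithinAt, by simp, ?_⟩
    rw [contDiffOn_zero]
    exact hc.congr fun x hx => Dv_eq h' hx
  rw [e, contDiffOn_succ_iff_derivWithin uniqueDiffOn_Icc_zero_one]
  refine ⟨fun x hx => (h x hx).differentiableWithinAt, by simp, ?_⟩
  exact h1.congr fun x hx => Dv_eq h hx

theorem cd2' {f : ℝ → ℝ} (h : ContDiffOn ℝ 2 f (Icc 0 1)) :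
    (∀ x ∈ Icc (0:ℝ) 1, HasDerivWithinAt f (Dv f x) (Icc 0 1) x) ∧
    (∀ x ∈ Icc (0:ℝ) 1, HasDerivWithinAt (Dv f) (Dv (Dv f) x) (Icc 0 1) x) ∧
    ContinuousOn (Dv (Dv f)) (Icc 0 1) := by
  have e : (2 : WithTop ℕ∞) = 1 + 1 := by norm_num
  have e1 : (1 : WithTop ℕ∞) = 0 + 1 := by norm_num
  rw [e, contDiffOn_succ_iff_derivWithin uniqueDiffOn_Icc_zero_one] at h
  obtain ⟨h1, -, h2⟩ := h
  rw [e1, contDiffOn_succ_iff_derivWithin uniqueDiffOn_Icc_zero_one] at h2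
  obtain ⟨h3, -, h4⟩ := h2
  exact ⟨fun x hx => (h1 x hx).hasDerivWithinAt, fun x hx => (h3 x hx).hasDerivWithinAt,
    h4.continuousOn⟩

theorem SolT.sys {p r y : ℝ → ℝ} {c lam : ℝ} (hp : ∀ x ∈ Icc (0:ℝ) 1, 0 < p x)
    (h : SolT p r c lam y) :
    Sys (clx p) (clx r) c lam (clx y) (clx (Dv y)) (clx (fun x => p x * Dv (Dv y) x))
      (clx (Dv (fun x => p x * Dv (Dv y) x))) := by
  obtain ⟨h1, h2, h3⟩ := h
  obtain ⟨a1, a2, a3⟩ := cd2' h1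
  obtain ⟨b1, b2, b3⟩ := cd2' h2
  refine ⟨⟨clx_cont fun x hx => (a1 x hx).continuousWithinAt,
    clx_cont fun x hx => (a2 x hx).continuousWithinAt,
    clx_cont fun x hx => (b1 x hx).continuousWithinAt,
    clx_cont fun x hx => (b2 x hx).continuousWithinAt⟩, fun x hx => ?_⟩
  have e : p x * Dv (Dv y) x / p x = Dv (Dv y) x := by
    field_simp [(hp x hx).ne']
  simp only [clx_eq _ hx, e]
  refine ⟨clx_deriv hx (a1 x hx), clx_deriv hx (a2 x hx), clx_deriv hx (b1 x hx),
    (clx_deriv hx (b2 x hx)).congr_deriv ?_⟩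
  linarith [h3 x hx]

theorem Sys.solT {p r y u q z : ℝ → ℝ} {c lam : ℝ} (hpc : ContinuousOn p (Icc 0 1))
    (hrc : ContinuousOn r (Icc 0 1)) (hp : ∀ x ∈ Icc (0:ℝ) 1, 0 < p x)
    (h : Sys (clx p) (clx r) c lam y u q z) :
    SolT p r c lam y ∧ Dv y 0 = u 0 ∧ Dv y 1 = u 1 ∧
      Dv (fun t => p t * Dv (Dv y) t) 1 = z 1 := by
  obtain ⟨⟨hy, hu, hq, hz⟩, h⟩ := h
  have h1 := fun x hx => (h x hx).1
  have h2 : ∀ x ∈ Icc (0:ℝ) 1, HasDerivWithinAt u (q x / p x) (Icc 0 1) x := fun x hx => by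
    have := (h x hx).2.1
    rwa [clx_eq p hx] at this
  have h3 := fun x hx => (h x hx).2.2.1
  have h4 : ∀ x ∈ Icc (0:ℝ) 1,
      HasDerivWithinAt z (lam * (-(q x / p x) + c * r x * y x)) (Icc 0 1) x := fun x hx => by
    have := (h x hx).2.2.2
    rwa [clx_eq p hx, clx_eq r hx] at this
  have cc : ContinuousOn (fun x => q x / p x) (Icc 0 1) :=
    hq.continuousOn.div hpc fun x hx => (hp x hx).ne'
  have e1 : ∀ x ∈ Icc (0:ℝ) 1, Dv y x = u x := fun x hx => Dv_eq h1 hx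
  have e2 : ∀ x ∈ Icc (0:ℝ) 1, Dv (Dv y) x = q x / p x := fun x hx => by
    rw [Dv_congr e1 hx, Dv_eq h2 hx]
  have e3 : ∀ x ∈ Icc (0:ℝ) 1, p x * Dv (Dv y) x = q x := fun x hx => by
    rw [e2 x hx]; field_simp [(hp x hx).ne']
  have e4 : ∀ x ∈ Icc (0:ℝ) 1, Dv (fun t => p t * Dv (Dv y) t) x = z x := fun x hx => by
    rw [Dv_congr e3 hx, Dv_eq h3 hx]
  refine ⟨⟨cd2 h1 h2 cc, (cd2 h3 h4 ?_).congr e3, fun x hx => ?_⟩, e1 0 (by simp), e1 1 (by simp),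
    e4 1 (by simp)⟩
  · exact continuousOn_const.mul (cc.neg.add ((continuousOn_const.mul hrc).mul hy.continuousOn))
  · rw [Dv_congr e4 hx, Dv_eq h4 hx, e2 x hx]; ring

theorem bridge1 {p r : ℝ → ℝ} (c lam : ℝ) (hpc : ContinuousOn p (Icc 0 1))
    (hrc : ContinuousOn r (Icc 0 1)) (hp : ∀ x ∈ Icc (0:ℝ) 1, 0 < p x) :
    EigT1 p r c lam ↔ SE1 (clx p) (clx r) c lam := by
  have m0 : (0:ℝ) ∈ Icc (0:ℝ) 1 := by simp
  have m1 : (1:ℝ) ∈ Icc (0:ℝ) 1 := by simp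
  constructor
  · rintro ⟨y, h, ⟨x, hx, hn⟩, b1, b2, b3, b4⟩
    exact ⟨_, _, _, _, h.sys hp, ⟨x, hx, by rwa [clx_eq y hx]⟩, by rwa [clx_eq _ m0],
      by rwa [clx_eq _ m0], by rwa [clx_eq _ m1], by rwa [clx_eq _ m1]⟩
  · rintro ⟨y, u, q, z, h, hn, b1, b2, b3, b4⟩
    obtain ⟨h1, h2, h3, h4⟩ := h.solT hpc hrc hp
    exact ⟨y, h1, hn, b1, by rwa [h2], b3, by rwa [h3]⟩

theorem bridge2 {p r : ℝ → ℝ} (c α lam : ℝ) (hpc : ContinuousOn p (Icc 0 1))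
    (hrc : ContinuousOn r (Icc 0 1)) (hp : ∀ x ∈ Icc (0:ℝ) 1, 0 < p x) :
    EigT2 p r c α lam ↔ SE2 (clx p) (clx r) c α lam := by
  have m0 : (0:ℝ) ∈ Icc (0:ℝ) 1 := by simp
  have m1 : (1:ℝ) ∈ Icc (0:ℝ) 1 := by simp
  constructor
  · rintro ⟨y, h, ⟨x, hx, hn⟩, b1, b2, b3, b4⟩
    exact ⟨_, _, _, _, h.sys hp, ⟨x, hx, by rwa [clx_eq y hx]⟩, by rwa [clx_eq _ m0],
      by rwa [clx_eq _ m0], by rwa [clx_eq _ m1], by rwa [clx_eq _ m1, clx_eq _ m1]⟩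
  · rintro ⟨y, u, q, z, h, hn, b1, b2, b3, b4⟩
    obtain ⟨h1, h2, h3, h4⟩ := h.solT hpc hrc hp
    exact ⟨y, h1, hn, b1, by rwa [h2], by rwa [h3], by rwa [h4]⟩

set_option linter.unusedSectionVars false
section
variable {H : Type*} [NormedAddCommGroup H] [InnerProductSpace ℝ H] [CompleteSpace H]
variable {p P : ℝ → ℝ} {φ : ℝ → H}

noncomputable def VV2 (φ : ℝ → H) : Submodule ℝ H := (Submodule.span ℝ {φ 1})ᗮ
noncomputable def VV1 (φ : ℝ → H) : Submodule ℝ H := (Submodule.span ℝ {φ 1, phi2 φ 1})ᗮ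

theorem mem_VV2 (φ : ℝ → H) (g : H) : g ∈ VV2 φ ↔ inner ℝ (φ 1) g = 0 := by
  rw [VV2, Submodule.mem_orthogonal_singleton_iff_inner_right]

theorem mem_VV1 (φ : ℝ → H) (g : H) :
    g ∈ VV1 φ ↔ inner ℝ (φ 1) g = 0 ∧ inner ℝ (phi2 φ 1) g = 0 := by
  rw [VV1, Submodule.mem_orthogonal]
  constructor
  · intro h
    exact ⟨h _ (Submodule.subset_span (by simp)), h _ (Submodule.subset_span (by simp))⟩
  · rintro ⟨h1, h2⟩ u hu
    obtain ⟨a, b, rfl⟩ := Submodule.mem_span_pair.1 hu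
    simp [inner_add_left, real_inner_smul_left, h1, h2]

theorem VV1_le (φ : ℝ → H) : VV1 φ ≤ VV2 φ := fun g hg => by
  rw [mem_VV1] at hg; rw [mem_VV2]; exact hg.1

theorem KRep.rep (h : KRep p P φ) {y u q z : ℝ → ℝ}
    (cz : Continuous z)
    (hy : ∀ x ∈ Icc (0:ℝ) 1, HasDerivWithinAt y (u x) (Icc 0 1) x)
    (hu : ∀ x ∈ Icc (0:ℝ) 1, HasDerivWithinAt u (q x / p x) (Icc 0 1) x)
    (hq : ∀ x ∈ Icc (0:ℝ) 1, HasDerivWithinAt q (z x) (Icc 0 1) x)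
    (y0 : y 0 = 0) (u0 : u 0 = 0) :
    ∃ g : H, (∀ s ∈ Icc (0:ℝ) 1, inner ℝ (φ s) g = u s) ∧
      (∀ s ∈ Icc (0:ℝ) 1, inner ℝ (phi2 φ s) g = y s) ∧
      ∀ v, inner ℝ (φ 1) v = 0 → inner ℝ g v = - ∫ x in (0:ℝ)..1, z x * inner ℝ (φ x) v := by
  have hφ := h.cont
  have h1 : ∀ s ∈ Icc (0:ℝ) 1,
      inner ℝ (φ s) (q 1 • φ 1 - ∫ x in (0:ℝ)..1, z x • φ x) = u s := by
    intro s hs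
    rw [inner_sub_right, h.key cz hs, real_inner_smul_right, h.gram s hs 1 (by simp),
      min_eq_left hs.2]
    have ht : ∀ t ∈ Icc (0:ℝ) 1, ∫ x in t..1, z x = q 1 - q t := by
      intro t ht
      have e1 := ftc hq cz ht
      have e2 := ftc hq cz (s := 1) (by simp)
      have e3 := intervalIntegral.integral_add_adjacent_intervals (a := 0) (b := t) (c := 1)
        (cz.intervalIntegrable (μ := volume) _ _) (cz.intervalIntegrable _ _)
      linarith
    have hcc : Continuous fun s => (∫ x in s..1, z x) / p s :=
      (tail_cont cz).div h.pc fun x => (h.ppos x).ne'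
    have := ftc (F := fun s => q 1 * P s - u s) (f := fun t => (∫ x in t..1, z x) / p t)
      (fun x hx => by
        refine (((h.Pd x).hasDerivWithinAt.const_mul (q 1)).sub (hu x hx)).congr_deriv ?_
        rw [ht x hx]; ring) hcc hs
    rw [this]
    simp [h.P0, u0]
  refine ⟨q 1 • φ 1 - ∫ x in (0:ℝ)..1, z x • φ x, h1, ?_, ?_⟩
  · intro s hs
    set g := q 1 • φ 1 - ∫ x in (0:ℝ)..1, z x • φ x
    have hc : Continuous fun x => (inner ℝ (φ x) g : ℝ) := by fun_prop
    have a1 := ftc (F := y) (f := fun x => (inner ℝ (φ x) g : ℝ))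
      (fun x hx => (hy x hx).congr_deriv (h1 x hx).symm) hc hs
    have a2 := ftc (F := fun x => (inner ℝ (phi2 φ x) g : ℝ)) (f := fun x => (inner ℝ (φ x) g : ℝ))
      (fun x hx => (inner_phi2_deriv hφ g x).hasDerivWithinAt) hc hs
    simp only [phi2_zero, inner_zero_left] at a2
    linarith
  · intro v hv
    rw [inner_sub_left, real_inner_smul_left, hv, inner_int (by fun_prop)]
    simp only [real_inner_smul_left]
    ring

theorem KRep.c2h (h : KRep p P φ) {r : ℝ → ℝ} (hr : Continuous r) {c lam : ℝ} (α : ℝ)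
    {y u q z : ℝ → ℝ} (hS : Sys p r c lam y u q z) (y0 : y 0 = 0) (u0 : u 0 = 0) (u1 : u 1 = 0) :
    ∃ g : H, (∀ s ∈ Icc (0:ℝ) 1, inner ℝ (φ s) g = u s) ∧
      (∀ s ∈ Icc (0:ℝ) 1, inner ℝ (phi2 φ s) g = y s) ∧
      ∀ v, inner ℝ (φ 1) v = 0 → lam * inner ℝ (Kop φ r c α g) v - inner ℝ g v =
        (lam * α * y 1 + z 1) * inner ℝ (phi2 φ 1) v := by
  have hφ := h.cont
  have hφ2 := phi2_cont hφ
  obtain ⟨⟨cy, cu, cq, cz⟩, hS⟩ := hS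
  obtain ⟨g, g1, g2, g3⟩ := h.rep cz (fun x hx => (hS x hx).1) (fun x hx => (hS x hx).2.1)
    (fun x hx => (hS x hx).2.2.1) y0 u0
  refine ⟨g, g1, g2, fun v hv => ?_⟩
  rw [g3 v hv, K_inner hφ hr, g2 1 (by simp)]
  have c1 : Continuous fun x => (inner ℝ (φ x) v : ℝ) := by fun_prop
  have c2 : Continuous fun x => (inner ℝ (phi2 φ x) v : ℝ) := by fun_prop
  have i1 : ∫ x in (0:ℝ)..1, (inner ℝ (φ x) g * inner ℝ (φ x) v : ℝ)
      = ∫ x in (0:ℝ)..1, u x * inner ℝ (φ x) v := by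
    refine intervalIntegral.integral_congr fun x hx => ?_
    rw [uIcc_of_le zero_le_one] at hx
    simp only [g1 x hx]
  have i2 : ∫ x in (0:ℝ)..1, (r x * inner ℝ (phi2 φ x) g * inner ℝ (phi2 φ x) v : ℝ)
      = ∫ x in (0:ℝ)..1, r x * y x * inner ℝ (phi2 φ x) v := by
    refine intervalIntegral.integral_congr fun x hx => ?_
    rw [uIcc_of_le zero_le_one] at hx
    simp only [g2 x hx]
  have i3 := ftc (F := fun x => z x * inner ℝ (phi2 φ x) v + lam * (u x * inner ℝ (phi2 φ x) v))
    (f := fun x => z x * inner ℝ (φ x) v + (lam * (u x * inner ℝ (φ x) v)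
      + lam * c * (r x * y x * inner ℝ (phi2 φ x) v)))
    (fun x hx => by
      have w := (inner_phi2_deriv hφ v x).hasDerivWithinAt (s := Icc 0 1)
      refine (((hS x hx).2.2.2.mul w).add
        (((hS x hx).2.1.mul w).const_mul lam)).congr_deriv ?_
      ring) (by fun_prop) (s := 1) (by simp)
  rw [intervalIntegral.integral_add (by apply Continuous.intervalIntegrable; fun_prop)
    (by apply Continuous.intervalIntegrable; fun_prop),
    intervalIntegral.integral_add (by apply Continuous.intervalIntegrable; fun_prop)
    (by apply Continuous.intervalIntegrable; fun_prop), intervalIntegral.integral_const_mul,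
    intervalIntegral.integral_const_mul] at i3
  simp only [u1, u0, phi2_zero, inner_zero_left] at i3
  rw [i1, i2]
  linarith

theorem KRep.h2c (h : KRep p P φ) {r : ℝ → ℝ} (hr : Continuous r) {c α μ a b : ℝ} (hμ : μ ≠ 0)
    {g : H} (hg : μ • g = Kop φ r c α g - a • φ 1 - b • phi2 φ 1) (hg1 : inner ℝ (φ 1) g = 0) :
    ∃ q z, Sys p r c (1 / μ) (fun s => inner ℝ (phi2 φ s) g) (fun s => inner ℝ (φ s) g) q z ∧
      z 1 + 1 / μ * α * inner ℝ (phi2 φ 1) g = b / μ := by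
  have hφ := h.cont
  have hφ2 := phi2_cont hφ
  set y : ℝ → ℝ := fun s => inner ℝ (phi2 φ s) g with hy
  set u : ℝ → ℝ := fun s => inner ℝ (φ s) g with hu
  have cy : Continuous y := by fun_prop
  have cu : Continuous u := by fun_prop
  have cry : Continuous fun x => r x * y x := hr.mul cy
  set m : ℝ → ℝ := fun x => u x + c * (∫ s in x..1, r s * y s) + (α * y 1 - b) with hm
  have cm : Continuous m := (cu.add (continuous_const.mul (tail_cont cry))).add continuous_const
  have e1 : Kop φ r c α g - b • phi2 φ 1 = ∫ x in (0:ℝ)..1, m x • φ x := by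
    rw [K_apply hφ hr, parts hφ cry]
    have ct := tail_cont cry
    have : ∀ x, m x • φ x = u x • φ x + (c • ((∫ s in x..1, r s * y s) • φ x)
        + (α * y 1 - b) • φ x) := by
      intro x; simp only [hm, add_smul, smul_smul, add_assoc]
    simp only [this]
    rw [intervalIntegral.integral_add (by apply Continuous.intervalIntegrable; fun_prop)
      (by apply Continuous.intervalIntegrable; fun_prop),
      intervalIntegral.integral_add (by apply Continuous.intervalIntegrable; fun_prop)
      (by apply Continuous.intervalIntegrable; fun_prop), intervalIntegral.integral_smul,
      intervalIntegral.integral_smul]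
    change _ = _ + (_ + (α * y 1 - b) • phi2 φ 1)
    rw [sub_smul]
    abel
  have ctm := tail_cont cm
  have cp := h.pc
  have hcc : Continuous fun s => (∫ x in s..1, m x) / p s :=
      ctm.div h.pc fun x => (h.ppos x).ne'
  have e2 : ∀ s ∈ Icc (0:ℝ) 1,
      u s = 1 / μ * ((∫ t in (0:ℝ)..s, (∫ x in t..1, m x) / p t) - a * P s) := by
    intro s hs
    have : μ * u s = (∫ t in (0:ℝ)..s, (∫ x in t..1, m x) / p t) - a * P s := by
      rw [hu]
      simp only
      rw [← real_inner_smul_right, hg, sub_right_comm, e1, inner_sub_right, h.key cm hs,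
        real_inner_smul_right, h.gram s hs 1 (by simp), min_eq_left hs.2]
    rw [← this]; field_simp
  have du : ∀ x ∈ Icc (0:ℝ) 1,
      HasDerivWithinAt u ((1 / μ * ((∫ s in x..1, m s) - a)) / p x) (Icc 0 1) x := by
    intro x hx
    have h1 : HasDerivAt (fun s => ∫ t in (0:ℝ)..s, (∫ x in t..1, m x) / p t)
        ((∫ s in x..1, m s) / p x) x :=
      intervalIntegral.integral_hasDerivAt_right (hcc.intervalIntegrable _ _)
        (hcc.stronglyMeasurableAtFilter _ _) hcc.continuousAt
    have h2 := ((h1.sub ((h.Pd x).const_mul a)).const_mul (1 / μ)).hasDerivWithinAt (s := Icc 0 1)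
    refine (h2.congr e2 (e2 x hx)).congr_deriv ?_
    ring
  refine ⟨fun x => 1 / μ * ((∫ s in x..1, m s) - a), fun x => 1 / μ * (- m x),
    ⟨⟨cy, cu, by fun_prop, by fun_prop⟩, fun x hx => ⟨?_, du x hx, ?_, ?_⟩⟩, ?_⟩
  · exact (inner_phi2_deriv hφ g x).hasDerivWithinAt
  · exact (((tail_deriv cm x).sub_const a).const_mul (1 / μ)).hasDerivWithinAt
  · have := (((du x hx).add ((tail_deriv cry x).hasDerivWithinAt.const_mul c)).add_const
      (α * y 1 - b)).neg.const_mul (1 / μ)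
    refine this.congr_deriv ?_
    ring
  · simp only [hm, hu, hg1, intervalIntegral.integral_same]
    ring

theorem yz_zero {φ : ℝ → H} (hφ : Continuous φ) {r : ℝ → ℝ} (hr : Continuous r) (c α : ℝ) {g : H}
    (hy : ∀ x ∈ Icc (0:ℝ) 1, inner ℝ (phi2 φ x) g = 0) (v : H) :
    inner ℝ (Kop φ r c α g) v = 0 := by
  have hu : ∀ x ∈ Icc (0:ℝ) 1, inner ℝ (φ x) g = 0 := by
    intro x hx
    have h1 := (inner_phi2_deriv hφ g x).hasDerivWithinAt (s := Icc 0 1)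
    have h2 : HasDerivWithinAt (fun x => (inner ℝ (phi2 φ x) g : ℝ)) 0 (Icc 0 1) x :=
      (hasDerivWithinAt_const x (Icc (0:ℝ) 1) (0:ℝ)).congr hy (hy x hx)
    exact (uniqueDiffOn_Icc_zero_one x hx).eq_deriv _ h1 h2
  rw [K_inner hφ hr, hy 1 (by simp)]
  have i1 : ∫ x in (0:ℝ)..1, (inner ℝ (φ x) g * inner ℝ (φ x) v : ℝ)
      = ∫ x in (0:ℝ)..1, (0:ℝ) := by
    refine intervalIntegral.integral_congr fun x hx => ?_
    rw [uIcc_of_le zero_le_one] at hx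
    simp only [hu x hx, zero_mul]
  have i2 : ∫ x in (0:ℝ)..1, (r x * inner ℝ (phi2 φ x) g * inner ℝ (phi2 φ x) v : ℝ)
      = ∫ x in (0:ℝ)..1, (0:ℝ) := by
    refine intervalIntegral.integral_congr fun x hx => ?_
    rw [uIcc_of_le zero_le_one] at hx
    simp only [hy x hx, mul_zero, zero_mul]
  rw [i1, i2]; simp

theorem ev_y {φ : ℝ → H} (hφ : Continuous φ) {r : ℝ → ℝ} (hr : Continuous r) {c α μ : ℝ} {g : H}
    (hμ : μ ≠ 0) {V : Submodule ℝ H} (hgV : g ∈ V)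
    (hE : ∀ v ∈ V, inner ℝ (Kop φ r c α g) v = μ * inner ℝ g v)
    (hy : ∀ x ∈ Icc (0:ℝ) 1, inner ℝ (phi2 φ x) g = 0) : g = 0 := by
  have := hE g hgV
  rw [yz_zero hφ hr c α hy] at this
  rcases mul_eq_zero.1 this.symm with h | h
  · exact absurd h hμ
  · exact inner_self_eq_zero.1 h

theorem KRep.ev2 (h : KRep p P φ) {r : ℝ → ℝ} (hr : Continuous r) {c α μ : ℝ} (hμ : μ ≠ 0)
    {g : H} (hE : IsEV (Kop φ r c α) (VV2 φ) μ g) :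
    ∃ q z, Sys p r c (1 / μ) (fun s => inner ℝ (phi2 φ s) g) (fun s => inner ℝ (φ s) g) q z ∧
      z 1 + 1 / μ * α * inner ℝ (phi2 φ 1) g = 0 := by
  obtain ⟨hg, hg0, hE⟩ := hE
  have : Kop φ r c α g - μ • g ∈ (Submodule.span ℝ {φ 1})ᗮᗮ := by
    rw [Submodule.mem_orthogonal']
    intro v hv
    rw [inner_sub_left, hE v hv, real_inner_smul_left, sub_self]
  rw [Submodule.orthogonal_orthogonal] at this
  obtain ⟨a, ha⟩ := Submodule.mem_span_singleton.1 this
  have := h.h2c hr (a := a) (b := 0) hμ (g := g) (c := c) (α := α)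
    (by rw [ha]; simp) ((mem_VV2 _ _).1 hg)
  simpa using this

theorem KRep.ev1 (h : KRep p P φ) {r : ℝ → ℝ} (hr : Continuous r) {c α μ : ℝ} (hμ : μ ≠ 0)
    {g : H} (hE : IsEV (Kop φ r c α) (VV1 φ) μ g) :
    ∃ q z, Sys p r c (1 / μ) (fun s => inner ℝ (phi2 φ s) g) (fun s => inner ℝ (φ s) g) q z := by
  obtain ⟨hg, hg0, hE⟩ := hE
  have : Kop φ r c α g - μ • g ∈ (Submodule.span ℝ {φ 1, phi2 φ 1})ᗮᗮ := by
    rw [Submodule.mem_orthogonal']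
    intro v hv
    rw [inner_sub_left, hE v hv, real_inner_smul_left, sub_self]
  have hfd : FiniteDimensional ℝ (Submodule.span ℝ {φ 1, phi2 φ 1}) :=
    FiniteDimensional.span_of_finite ℝ (by simp)
  rw [Submodule.orthogonal_orthogonal] at this
  obtain ⟨a, b, ha⟩ := Submodule.mem_span_pair.1 this
  obtain ⟨q, z, h1, -⟩ := h.h2c hr (a := a) (b := b) hμ (g := g) (c := c) (α := α)
    (by rw [sub_sub, ha]; simp) ((mem_VV1 _ _).1 hg).1
  exact ⟨q, z, h1⟩

theorem ev_nontriv {φ : ℝ → H} (hφ : Continuous φ) {r : ℝ → ℝ} (hr : Continuous r) {c α μ : ℝ}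
    {g : H} (hμ : μ ≠ 0) {V : Submodule ℝ H} (hE : IsEV (Kop φ r c α) V μ g) :
    Nontriv (fun s => (inner ℝ (phi2 φ s) g : ℝ)) := by
  by_contra hn
  simp only [Nontriv, not_exists, not_and, not_not] at hn
  exact hE.2.1 (ev_y hφ hr hμ hE.1 hE.2.2 hn)

theorem KRep.se2 (h : KRep p P φ) {r : ℝ → ℝ} (hr : Continuous r) {c α μ : ℝ} (hμ : μ ≠ 0)
    {g : H} (hE : IsEV (Kop φ r c α) (VV2 φ) μ g) : SE2 p r c α (1 / μ) := by
  obtain ⟨q, z, h1, h2⟩ := h.ev2 hr hμ hE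
  exact ⟨_, _, q, z, h1, ev_nontriv h.cont hr hμ hE, by simp [phi2_zero], by simp [h.phi_zero],
    (mem_VV2 _ _).1 hE.1, h2⟩

theorem KRep.se1 (h : KRep p P φ) {r : ℝ → ℝ} (hr : Continuous r) {c α μ : ℝ} (hμ : μ ≠ 0)
    {g : H} (hE : IsEV (Kop φ r c α) (VV1 φ) μ g) : SE1 p r c (1 / μ) := by
  obtain ⟨q, z, h1⟩ := h.ev1 hr hμ hE
  exact ⟨_, _, q, z, h1, ev_nontriv h.cont hr hμ hE, by simp [phi2_zero], by simp [h.phi_zero],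
    ((mem_VV1 _ _).1 hE.1).2, ((mem_VV1 _ _).1 hE.1).1⟩

theorem KRep.es2 (h : KRep p P φ) {r : ℝ → ℝ} (hr : Continuous r) {c α lam : ℝ} (hl : lam ≠ 0)
    (hE : SE2 p r c α lam) : ∃ g, IsEV (Kop φ r c α) (VV2 φ) (1 / lam) g := by
  obtain ⟨y, u, q, z, hS, ⟨x, hx, hn⟩, y0, u0, u1, hz⟩ := hE
  obtain ⟨g, g1, g2, g3⟩ := h.c2h hr α hS y0 u0 u1
  refine ⟨g, ?_, ?_, ?_⟩
  · rw [mem_VV2, g1 1 (by simp), u1]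
  · rintro rfl
    exact hn (by rw [← g2 x hx]; simp)
  · intro v hv
    have := g3 v ((mem_VV2 _ _).1 hv)
    rw [add_comm, hz, zero_mul] at this
    field_simp
    linarith

theorem KRep.es1 (h : KRep p P φ) {r : ℝ → ℝ} (hr : Continuous r) {c lam : ℝ} (α : ℝ)
    (hl : lam ≠ 0)
    (hE : SE1 p r c lam) : ∃ g, IsEV (Kop φ r c α) (VV1 φ) (1 / lam) g := by
  obtain ⟨y, u, q, z, hS, ⟨x, hx, hn⟩, y0, u0, y1, u1⟩ := hE
  obtain ⟨g, g1, g2, g3⟩ := h.c2h hr α hS y0 u0 u1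
  refine ⟨g, ?_, ?_, ?_⟩
  · rw [mem_VV1, g1 1 (by simp), u1, g2 1 (by simp), y1]; simp
  · rintro rfl
    exact hn (by rw [← g2 x hx]; simp)
  · intro v hv
    have := g3 v ((mem_VV1 _ _).1 hv).1
    rw [((mem_VV1 _ _).1 hv).2, mul_zero] at this
    field_simp
    linarith

end
set_option linter.unusedSectionVars false

theorem Sys.comb {p r y u q z y' u' q' z' : ℝ → ℝ} {c lam : ℝ} (h : Sys p r c lam y u q z)
    (h' : Sys p r c lam y' u' q' z') (a b : ℝ) :
    Sys p r c lam (fun x => a * y x - b * y' x) (fun x => a * u x - b * u' x)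
      (fun x => a * q x - b * q' x) (fun x => a * z x - b * z' x) := by
  obtain ⟨⟨cy, cu, cq, cz⟩, h⟩ := h
  obtain ⟨⟨cy', cu', cq', cz'⟩, h'⟩ := h'
  refine ⟨⟨by fun_prop, by fun_prop, by fun_prop, by fun_prop⟩, fun x hx => ?_⟩
  obtain ⟨h1, h2, h3, h4⟩ := h x hx
  obtain ⟨k1, k2, k3, k4⟩ := h' x hx
  refine ⟨(h1.const_mul a).sub (k1.const_mul b), ?_, (h3.const_mul a).sub (k3.const_mul b), ?_⟩
  · exact ((h2.const_mul a).sub (k2.const_mul b)).congr_deriv (by ring)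
  · exact ((h4.const_mul a).sub (k4.const_mul b)).congr_deriv (by ring)

theorem Sys.coop {p r y u q z : ℝ → ℝ} {c lam : ℝ} (h : Sys p r c lam y u q z)
    (cp : Continuous p) (cr : Continuous r) (pp : ∀ x, 0 < p x) (rp : ∀ x, 0 < r x)
    (hc : c < 0) (hl : lam < 0) :
    ∃ α β γ : ℝ → ℝ, ∃ L : ℝ, 1 ≤ L ∧ (∀ x ∈ Icc (0:ℝ) 1, 0 ≤ α x ∧ α x ≤ L) ∧
      (∀ x ∈ Icc (0:ℝ) 1, 0 ≤ β x) ∧ (∀ x ∈ Icc (0:ℝ) 1, 0 ≤ γ x) ∧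
      (∀ x ∈ Icc (0:ℝ) 1, β x + γ x ≤ L) ∧ Coop α β γ y u q z := by
  have c1 : Continuous fun x => 1 / p x := continuous_const.div cp fun x => (pp x).ne'
  have c2 : Continuous fun x => -lam / p x + lam * c * r x :=
    (continuous_const.div cp fun x => (pp x).ne').add (continuous_const.mul cr)
  obtain ⟨L1, hL1⟩ := isCompact_Icc.exists_bound_of_continuousOn (c1.continuousOn (s := Icc 0 1))
  obtain ⟨L2, hL2⟩ := isCompact_Icc.exists_bound_of_continuousOn (c2.continuousOn (s := Icc 0 1))
  refine ⟨fun x => 1 / p x, fun x => -lam / p x, fun x => lam * c * r x, max 1 (max L1 L2),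
    le_max_left _ _, fun x hx => ⟨(one_div_pos.2 (pp x)).le, ?_⟩,
    fun x hx => (div_pos (neg_pos.2 hl) (pp x)).le,
    fun x hx => (mul_pos (mul_pos_of_neg_of_neg hl hc) (rp x)).le, fun x hx => ?_, fun x hx => ?_⟩
  · exact ((le_abs_self _).trans (hL1 x hx)).trans ((le_max_left _ _).trans (le_max_right _ _))
  · exact ((le_abs_self _).trans (hL2 x hx)).trans ((le_max_right _ _).trans (le_max_right _ _))
  · obtain ⟨h1, h2, h3, h4⟩ := h.2 x hx
    exact ⟨h1, h2.congr_deriv (by ring), h3, h4.congr_deriv (by ring)⟩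

theorem Sys.zf {p r y u q z : ℝ → ℝ} {c lam : ℝ} (h : Sys p r c lam y u q z)
    (cp : Continuous p) (cr : Continuous r) (pp : ∀ x, 0 < p x) (rp : ∀ x, 0 < r x)
    (hc : c < 0) (hl : lam < 0) (hy : y 0 = 0) (hu : u 0 = 0) (hq : q 0 = 0) (hu1 : u 1 = 0) :
    ∀ x ∈ Icc (0:ℝ) 1, y x = 0 := by
  obtain ⟨α, β, γ, L, a1, a2, a3, a4, a5, a6⟩ := h.coop cp cr pp rp hc hl
  exact a6.zero_fwd a1 a2 a3 a4 a5 hy hu hq hu1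

theorem Sys.zb {p r y u q z : ℝ → ℝ} {c lam : ℝ} (h : Sys p r c lam y u q z)
    (cp : Continuous p) (cr : Continuous r) (pp : ∀ x, 0 < p x) (rp : ∀ x, 0 < r x)
    (hc : c < 0) (hl : lam < 0) (hy : y 0 = 0) (hy1 : y 1 = 0) (hu1 : u 1 = 0) (hz : z 1 = 0) :
    ∀ x ∈ Icc (0:ℝ) 1, y x = 0 := by
  obtain ⟨α, β, γ, L, a1, a2, a3, a4, a5, a6⟩ := h.coop cp cr pp rp hc hl
  exact a6.zero_bwd a1 a2 a3 a4 a5 hy hy1 hu1 hz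

theorem SE_disj {p r : ℝ → ℝ} {c α lam : ℝ}
    (cp : Continuous p) (cr : Continuous r) (pp : ∀ x, 0 < p x) (rp : ∀ x, 0 < r x)
    (hc : c < 0) (hl : lam < 0) (h1 : SE1 p r c lam) (h2 : SE2 p r c α lam) : False := by
  obtain ⟨y, u, q, z, hS, ⟨x, hx, hn⟩, y0, u0, y1, u1⟩ := h1
  obtain ⟨y', u', q', z', hS', ⟨x', hx', hn'⟩, y0', u0', u1', hz'⟩ := h2
  have hq : q 0 ≠ 0 := fun hq => hn (hS.zf cp cr pp rp hc hl y0 u0 hq u1 x hx)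
  have e := (hS.comb hS' (q' 0) (q 0)).zf cp cr pp rp hc hl (by simp [y0, y0'])
    (by simp [u0, u0']) (by ring) (by simp [u1, u1']) 1 (by simp)
  simp only [y1, mul_zero, zero_sub, neg_eq_zero, mul_eq_zero, hq, false_or] at e
  refine hn' (hS'.zb cp cr pp rp hc hl y0' e u1' ?_ x' hx')
  simpa [e] using hz'

section
variable {H : Type*} [NormedAddCommGroup H] [InnerProductSpace ℝ H] [CompleteSpace H]
variable {p P : ℝ → ℝ} {φ : ℝ → H}

theorem KRep.simple_aux (h : KRep p P φ) {r : ℝ → ℝ} (cr : Continuous r) (rp : ∀ x, 0 < r x)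
    {c α μ : ℝ} (hc : c < 0) (hμ : μ < 0) {V : Submodule ℝ H} (hV : V ≤ VV2 φ)
    (hsys : ∀ g, IsEV (Kop φ r c α) V μ g → ∃ q z, Sys p r c (1 / μ)
      (fun s => inner ℝ (phi2 φ s) g) (fun s => inner ℝ (φ s) g) q z)
    (g g' : H) (hg : IsEV (Kop φ r c α) V μ g) (hg' : IsEV (Kop φ r c α) V μ g') :
    inner ℝ g g' ≠ 0 := by
  have hl : 1 / μ < 0 := one_div_neg.2 hμ
  obtain ⟨q, z, hS⟩ := hsys g hg
  obtain ⟨q', z', hS'⟩ := hsys g' hg'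
  have nz : ∀ g q z, IsEV (Kop φ r c α) V μ g → Sys p r c (1 / μ)
      (fun s => inner ℝ (phi2 φ s) g) (fun s => inner ℝ (φ s) g) q z → q 0 ≠ 0 := by
    intro g q z hg hS hq
    refine hg.2.1 (ev_y h.cont cr hμ.ne hg.1 hg.2.2 ?_)
    exact hS.zf h.pc cr h.ppos rp hc hl (by simp [phi2_zero]) (by simp [h.phi_zero]) hq
      ((mem_VV2 _ _).1 (hV hg.1))
  have n1 := nz g q z hg hS
  have n2 := nz g' q' z' hg' hS'
  have hz := (hS.comb hS' (q' 0) (q 0)).zf h.pc cr h.ppos rp hc hl (by simp [phi2_zero])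
    (by simp [h.phi_zero]) (by ring)
    (by simp [(mem_VV2 _ _).1 (hV hg.1), (mem_VV2 _ _).1 (hV hg'.1)])
  have hG : q' 0 • g - q 0 • g' = 0 := by
    refine ev_y (V := V) (c := c) (α := α) h.cont cr hμ.ne
      (V.sub_mem (V.smul_mem _ hg.1) (V.smul_mem _ hg'.1)) ?_ ?_
    · intro v hv
      rw [map_sub, map_smul, map_smul, inner_sub_left, inner_sub_left, real_inner_smul_left,
        real_inner_smul_left, real_inner_smul_left, real_inner_smul_left, hg.2.2 v hv,
        hg'.2.2 v hv]
      ring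
    · intro x hx
      rw [inner_sub_right, real_inner_smul_right, real_inner_smul_right]
      exact hz x hx
  intro h0
  have h3 : inner ℝ (q' 0 • g - q 0 • g') g' = (0:ℝ) := by rw [hG, inner_zero_left]
  rw [inner_sub_left, real_inner_smul_left, real_inner_smul_left, h0, mul_zero, zero_sub,
    neg_eq_zero, mul_eq_zero] at h3
  rcases h3 with h3 | h3
  · exact n1 h3
  · exact hg'.2.1 (inner_self_eq_zero.1 h3)

theorem cnt (K : H →L[ℝ] H) (hc : IsCompactOperator K)
    (hs : ∀ x y, inner ℝ (K x) y = inner ℝ x (K y)) (V V' : Submodule ℝ H)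
    (hV : IsClosed (V : Set H)) {E E' : ℝ → Prop}
    (hE : ∀ ν < 0, ∀ g, IsEV K V ν g → E (1 / ν))
    (hE' : ∀ l < 0, E' l → ∃ g, IsEV K V' (1 / l) g)
    (hsimple : ∀ ν < 0, ∀ g g', IsEV K V ν g → IsEV K V ν g' → inner ℝ g g' ≠ (0:ℝ))
    {l l' : ℝ} {a b : ℕ} (hl : NthNegEig E a l) (hl' : NthNegEig E' b l') (hll : l < l')
    (k : ℕ) (ψ : Fin k → H) (hψ : ∀ g ∈ V', (∀ i, inner ℝ (ψ i) g = (0:ℝ)) → g ∈ V)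
    (hab : a - 1 + k < b) : False := by
  classical
  obtain ⟨ln, lE, lf, lc⟩ := hl
  obtain ⟨ln', lE', lf', lc'⟩ := hl'
  have hinj : Function.Injective (fun x : ℝ => 1 / x) := by
    intro x y hxy
    simpa using hxy
  rw [ncard_eq_toFinset_card _ lf] at lc
  rw [ncard_eq_toFinset_card _ lf'] at lc'
  have hn : 1 / l' < 0 := one_div_neg.2 ln'
  refine count_lemma K hc hs V V' hV (1 / l') hn (lf.toFinset.image fun x => 1 / x)
    ((insert l' lf'.toFinset).image fun x => 1 / x) ?_ ?_ ?_ k ψ hψ ?_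
  · intro ν hν g hg
    have hν0 : ν < 0 := hν.trans_lt hn
    rw [Finset.mem_image]
    refine ⟨1 / ν, ?_, by simp⟩
    rw [lf.mem_toFinset]
    refine ⟨hE ν hν0 g hg, ?_, one_div_neg.2 hν0⟩
    refine hll.trans_le ?_
    have := one_div_le_one_div_of_neg_of_le hn hν
    simpa using this
  · intro ν hν
    exact hsimple ν (hν.trans_lt hn)
  · intro t ht
    obtain ⟨x, hx, rfl⟩ := Finset.mem_image.1 ht
    have hx2 : l' ≤ x ∧ x < 0 ∧ E' x := by
      rw [Finset.mem_insert, lf'.mem_toFinset] at hx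
      rcases hx with rfl | ⟨h1, h2, h3⟩
      · exact ⟨le_rfl, ln', lE'⟩
      · exact ⟨h2.le, h3, h1⟩
    exact ⟨one_div_le_one_div_of_neg_of_le hx2.2.1 hx2.1, hE' x hx2.2.1 hx2.2.2⟩
  · rw [Finset.card_image_of_injective _ hinj, Finset.card_image_of_injective _ hinj,
      Finset.card_insert_of_notMem (by simp), lc, lc']
    omega

theorem KRep.no_neg (h : KRep p P φ) {r : ℝ → ℝ} (cr : Continuous r) (rp : ∀ x, 0 < r x)
    {c lam : ℝ} (hc : 0 ≤ c) (hl : lam < 0) (hE : SE1 p r c lam) : False := by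
  obtain ⟨g, hg, hg0, hE⟩ := h.es1 cr 0 hl.ne hE
  have e := hE g hg
  rw [K_inner h.cont cr] at e
  have i1 : 0 ≤ ∫ x in (0:ℝ)..1, (inner ℝ (φ x) g * inner ℝ (φ x) g : ℝ) :=
    intervalIntegral.integral_nonneg zero_le_one fun x _ => mul_self_nonneg _
  have i2 : 0 ≤ ∫ x in (0:ℝ)..1, (r x * inner ℝ (phi2 φ x) g * inner ℝ (phi2 φ x) g : ℝ) :=
    intervalIntegral.integral_nonneg zero_le_one fun x _ => by
      rw [mul_assoc]; exact mul_nonneg (rp x).le (mul_self_nonneg _)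
  have i3 : 0 < inner ℝ g g := real_inner_self_pos.2 hg0
  have i4 := mul_neg_of_neg_of_pos (one_div_neg.2 hl) i3
  have i5 := mul_nonneg hc i2
  linarith

theorem VV1_closed (φ : ℝ → H) : IsClosed (VV1 φ : Set H) := Submodule.isClosed_orthogonal _
theorem VV2_closed (φ : ℝ → H) : IsClosed (VV2 φ : Set H) := Submodule.isClosed_orthogonal _

theorem KRep.part_a (h : KRep p P φ) {r : ℝ → ℝ} (cr : Continuous r) (rp : ∀ x, 0 < r x)
    {c α : ℝ} {n : ℕ} (hn : 1 ≤ n) {lam lam' : ℝ} (h1 : NthNegEig (SE1 p r c) n lam)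
    (h2 : NthNegEig (SE2 p r c α) n lam') : lam < lam' := by
  rcases le_or_gt 0 c with hc | hc
  · exact (h.no_neg cr rp hc h1.1 h1.2.1).elim
  by_contra! hle
  have hlt : lam' < lam := by
    refine lt_of_le_of_ne hle ?_
    rintro rfl
    exact SE_disj h.pc cr h.ppos rp hc h1.1 h1.2.1 h2.2.1
  refine cnt (Kop φ r c α) (K_compact h.cont cr c α) (K_symm h.cont cr c α) (VV2 φ) (VV1 φ)
    (VV2_closed φ) (fun ν hν g hg => h.se2 cr hν.ne hg) (fun l hl hE => h.es1 cr α hl.ne hE)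
    (fun ν hν g g' => h.simple_aux cr rp hc hν le_rfl
      (fun g hg => ?_) g g') h2 h1 hlt 0 Fin.elim0 (fun g hg _ => VV1_le φ hg) (by omega)
  obtain ⟨q, z, hS, -⟩ := h.ev2 cr hν.ne hg
  exact ⟨q, z, hS⟩

theorem KRep.part_b (h : KRep p P φ) {r : ℝ → ℝ} (cr : Continuous r) (rp : ∀ x, 0 < r x)
    {c α : ℝ} {n : ℕ} (hn : 1 ≤ n) {lam nu : ℝ} (h1 : NthNegEig (SE1 p r c) n lam)
    (h2 : NthNegEig (SE2 p r c α) (n + 1) nu) : nu < lam := by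
  rcases le_or_gt 0 c with hc | hc
  · exact (h.no_neg cr rp hc h1.1 h1.2.1).elim
  by_contra! hle
  have hlt : lam < nu := by
    refine lt_of_le_of_ne hle ?_
    rintro rfl
    exact SE_disj h.pc cr h.ppos rp hc h1.1 h1.2.1 h2.2.1
  refine cnt (Kop φ r c α) (K_compact h.cont cr c α) (K_symm h.cont cr c α) (VV1 φ) (VV2 φ)
    (VV1_closed φ) (fun ν hν g hg => h.se1 cr hν.ne hg) (fun l hl hE => h.es2 cr hl.ne hE)
    (fun ν hν g g' => h.simple_aux cr rp hc hν (VV1_le φ)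
      (fun g hg => h.ev1 cr hν.ne hg) g g') h1 h2 hlt 1 (fun _ => phi2 φ 1)
    (fun g hg hi => (mem_VV1 _ _).2 ⟨(mem_VV2 _ _).1 hg, hi 0⟩) (by omega)

end
set_option linter.unusedSectionVars false

section
variable {H : Type*} [NormedAddCommGroup H] [InnerProductSpace ℝ H] [CompleteSpace H]
variable {p P : ℝ → ℝ} {φ : ℝ → H}

theorem KRep.rep_norm (h : KRep p P φ) {y u q z : ℝ → ℝ}
    (cu : Continuous u) (cq : Continuous q) (cz : Continuous z)
    (hy : ∀ x ∈ Icc (0:ℝ) 1, HasDerivWithinAt y (u x) (Icc 0 1) x)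
    (hu : ∀ x ∈ Icc (0:ℝ) 1, HasDerivWithinAt u (q x / p x) (Icc 0 1) x)
    (hq : ∀ x ∈ Icc (0:ℝ) 1, HasDerivWithinAt q (z x) (Icc 0 1) x)
    (y0 : y 0 = 0) (u0 : u 0 = 0) (u1 : u 1 = 0) :
    ∃ g : H, (∀ s ∈ Icc (0:ℝ) 1, inner ℝ (φ s) g = u s) ∧
      (∀ s ∈ Icc (0:ℝ) 1, inner ℝ (phi2 φ s) g = y s) ∧
      inner ℝ g g = ∫ x in (0:ℝ)..1, q x ^ 2 / p x := by
  obtain ⟨g, g1, g2, g3⟩ := h.rep cz hy hu hq y0 u0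
  refine ⟨g, g1, g2, ?_⟩
  have cp := h.pc
  have c1 : Continuous fun x => q x ^ 2 / p x := (cq.pow 2).div cp fun x => (h.ppos x).ne'
  rw [g3 g (by rw [g1 1 (by simp), u1])]
  have i1 : ∫ x in (0:ℝ)..1, z x * inner ℝ (φ x) g = ∫ x in (0:ℝ)..1, z x * u x := by
    refine intervalIntegral.integral_congr fun x hx => ?_
    rw [uIcc_of_le zero_le_one] at hx
    simp only [g1 x hx]
  have i2 := ftc (F := fun x => q x * u x) (f := fun x => z x * u x + q x ^ 2 / p x)
    (fun x hx => ((hq x hx).mul (hu x hx)).congr_deriv (by ring)) (by fun_prop) (s := 1) (by simp)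
  rw [intervalIntegral.integral_add (by apply Continuous.intervalIntegrable; fun_prop)
    (c1.intervalIntegrable _ _)] at i2
  simp only [u0, u1, mul_zero, sub_zero] at i2
  rw [i1]
  linarith

theorem K_quad {φ : ℝ → H} (hφ : Continuous φ) {r : ℝ → ℝ} (cr : Continuous r) (c α : ℝ) {g : H}
    {y u : ℝ → ℝ} (g1 : ∀ s ∈ Icc (0:ℝ) 1, inner ℝ (φ s) g = u s)
    (g2 : ∀ s ∈ Icc (0:ℝ) 1, inner ℝ (phi2 φ s) g = y s) :
    inner ℝ (Kop φ r c α g) g = (∫ x in (0:ℝ)..1, u x ^ 2)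
      + c * (∫ x in (0:ℝ)..1, r x * y x ^ 2) + α * y 1 ^ 2 := by
  rw [K_inner hφ cr, g2 1 (by simp)]
  have i1 : ∫ x in (0:ℝ)..1, (inner ℝ (φ x) g * inner ℝ (φ x) g : ℝ)
      = ∫ x in (0:ℝ)..1, u x ^ 2 := by
    refine intervalIntegral.integral_congr fun x hx => ?_
    rw [uIcc_of_le zero_le_one] at hx
    simp only [g1 x hx, sq]
  have i2 : ∫ x in (0:ℝ)..1, (r x * inner ℝ (phi2 φ x) g * inner ℝ (phi2 φ x) g : ℝ)
      = ∫ x in (0:ℝ)..1, r x * y x ^ 2 := by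
    refine intervalIntegral.integral_congr fun x hx => ?_
    rw [uIcc_of_le zero_le_one] at hx
    simp only [g2 x hx]; ring
  rw [i1, i2]; ring

theorem phi_ex {u r : ℝ → ℝ} (cu : Continuous u) (cr : Continuous r) (rp : ∀ x, 0 < r x)
    {y : ℝ → ℝ} (cy : Continuous y) {c : ℝ} (hc : 0 < c)
    (hy : ∀ x ∈ Icc (0:ℝ) 1, y x = ∫ t in (0:ℝ)..x, u t) (y1 : y 1 = 0)
    (hn : ∃ x ∈ Icc (0:ℝ) 1, u x ≠ 0) :
    ∃ ε > 0, (∫ x in (0:ℝ)..1, u x ^ 2) + c * (∫ x in (0:ℝ)..1, r x * y x ^ 2) <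
      (∫ x in (0:ℝ)..1, (Real.sqrt (u x ^ 2 + ε ^ 2) - ε) ^ 2) + c * (∫ x in (0:ℝ)..1,
        r x * (∫ t in (0:ℝ)..x, (Real.sqrt (u t ^ 2 + ε ^ 2) - ε)) ^ 2) := by
  set Φ : ℝ → ℝ := fun ε => (∫ x in (0:ℝ)..1, (Real.sqrt (u x ^ 2 + ε ^ 2) - ε) ^ 2)
    + c * (∫ x in (0:ℝ)..1,
        r x * (∫ t in (0:ℝ)..x, (Real.sqrt (u t ^ 2 + ε ^ 2) - ε)) ^ 2) with hΦ
  have cA : Continuous fun e : ℝ × ℝ => ∫ t in (0:ℝ)..e.2, (Real.sqrt (u t ^ 2 + e.1 ^ 2) - e.1) :=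
    intervalIntegral.continuous_parametric_intervalIntegral_of_continuous
      (f := fun (e : ℝ × ℝ) t => Real.sqrt (u t ^ 2 + e.1 ^ 2) - e.1)
      (by unfold Function.uncurry; fun_prop) continuous_snd
  have cΦ : Continuous Φ := by
    refine Continuous.add ?_ (continuous_const.mul ?_)
    · exact intervalIntegral.continuous_parametric_intervalIntegral_of_continuous
        (f := fun (ε : ℝ) x => (Real.sqrt (u x ^ 2 + ε ^ 2) - ε) ^ 2)
        (by unfold Function.uncurry; fun_prop) continuous_const
    · refine intervalIntegral.continuous_parametric_intervalIntegral_of_continuous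
        (f := fun (ε : ℝ) x => r x * (∫ t in (0:ℝ)..x, (Real.sqrt (u t ^ 2 + ε ^ 2) - ε)) ^ 2)
        ?_ continuous_const
      exact (cr.comp continuous_snd).mul (cA.pow 2)
  have h0 : (∫ x in (0:ℝ)..1, u x ^ 2) + c * (∫ x in (0:ℝ)..1, r x * y x ^ 2) < Φ 0 := by
    have e0 : Φ 0 = (∫ x in (0:ℝ)..1, u x ^ 2) + c * (∫ x in (0:ℝ)..1,
        r x * (∫ t in (0:ℝ)..x, |u t|) ^ 2) := by
      simp only [hΦ, ne_eq, OfNat.ofNat_ne_zero, not_false_eq_true, zero_pow, add_zero, sub_zero,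
        Real.sqrt_sq_eq_abs, sq_abs]
    rw [e0]
    have cB : Continuous fun x => ∫ t in (0:ℝ)..x, |u t| :=
      intervalIntegral.continuous_primitive (fun a b => cu.abs.intervalIntegrable a b) 0
    have hpos : 0 < ∫ x in (0:ℝ)..1, (r x * (∫ t in (0:ℝ)..x, |u t|) ^ 2 - r x * y x ^ 2) := by
      refine intervalIntegral.integral_pos zero_lt_one (by fun_prop) ?_ ⟨1, by simp, ?_⟩
      · intro x hx
        have hx' : x ∈ Icc (0:ℝ) 1 := ⟨hx.1.le, hx.2⟩
        have h1 : |y x| ≤ ∫ t in (0:ℝ)..x, |u t| := by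
          rw [hy x hx']
          exact intervalIntegral.abs_integral_le_integral_abs hx'.1
        have h2 : y x ^ 2 ≤ (∫ t in (0:ℝ)..x, |u t|) ^ 2 := by
          rw [← sq_abs (y x)]
          exact pow_le_pow_left₀ (abs_nonneg _) h1 2
        have := mul_le_mul_of_nonneg_left h2 (rp x).le
        linarith
      · have h1 : 0 < ∫ t in (0:ℝ)..1, |u t| := by
          obtain ⟨x, hx, hu⟩ := hn
          exact intervalIntegral.integral_pos zero_lt_one (by fun_prop)
            (fun _ _ => abs_nonneg _) ⟨x, hx, abs_pos.2 hu⟩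
        have := mul_pos (rp 1) (pow_pos h1 2)
        simpa [y1] using this
    rw [intervalIntegral.integral_sub (by apply Continuous.intervalIntegrable; fun_prop)
      (by apply Continuous.intervalIntegrable; fun_prop)] at hpos
    have := mul_pos hc hpos
    linarith
  have hev : ∀ᶠ ε in 𝓝[>] (0:ℝ),
      (∫ x in (0:ℝ)..1, u x ^ 2) + c * (∫ x in (0:ℝ)..1, r x * y x ^ 2) < Φ ε :=
    (cΦ.tendsto 0).mono_left nhdsWithin_le_nhds |>.eventually (lt_mem_nhds h0)
  obtain ⟨ε, h1, h2⟩ := (hev.and self_mem_nhdsWithin).exists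
  exact ⟨ε, h2, h1⟩

theorem KRep.part_c (h : KRep p P φ) {r : ℝ → ℝ} (cr : Continuous r) (rp : ∀ x, 0 < r x)
    {c α lam : ℝ} (hc : 0 < c) (hα : 0 ≤ α) (hl : 0 < lam) (hE : SE1 p r c lam) :
    ∃ μ, 0 < μ ∧ μ < lam ∧ SE2 p r c α μ := by
  have hφ := h.cont
  have cp := h.pc
  obtain ⟨y, u, q, z, hS, hn, y0, u0, y1, u1⟩ := hE
  obtain ⟨⟨cy, cu, cq, cz⟩, hS⟩ := hS
  have hy := fun x hx => (hS x hx).1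
  have hu := fun x hx => (hS x hx).2.1
  have hq := fun x hx => (hS x hx).2.2.1
  have hyint : ∀ x ∈ Icc (0:ℝ) 1, y x = ∫ t in (0:ℝ)..x, u t := by
    intro x hx
    rw [ftc hy cu hx, y0, sub_zero]
  have hen : lam * ((∫ x in (0:ℝ)..1, u x ^ 2) + c * (∫ x in (0:ℝ)..1, r x * y x ^ 2))
      = ∫ x in (0:ℝ)..1, q x ^ 2 / p x := by
    have i1 := ftc (F := fun x => z x * y x - q x * u x + lam * (u x * y x))
      (f := fun x => lam * u x ^ 2 + (lam * c * (r x * y x ^ 2) - q x ^ 2 / p x))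
      (fun x hx => by
        obtain ⟨a1, a2, a3, a4⟩ := hS x hx
        refine (((a4.mul a1).sub (a3.mul a2)).add ((a2.mul a1).const_mul lam)).congr_deriv ?_
        ring)
      (((cu.pow 2).const_mul _).add ((by fun_prop : Continuous fun x => lam * c * (r x * y x ^ 2)).sub
        ((cq.pow 2).div cp fun x => (h.ppos x).ne'))) (s := 1) (by simp)
    have c1 : Continuous fun x => q x ^ 2 / p x := (cq.pow 2).div cp fun x => (h.ppos x).ne'
    rw [intervalIntegral.integral_add (by apply Continuous.intervalIntegrable; fun_prop)
      (by apply Continuous.intervalIntegrable; fun_prop),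
      intervalIntegral.integral_sub (by apply Continuous.intervalIntegrable; fun_prop)
      (by apply Continuous.intervalIntegrable; fun_prop), intervalIntegral.integral_const_mul,
      intervalIntegral.integral_const_mul] at i1
    simp only [u0, u1, y0, y1] at i1
    linarith
  obtain ⟨ε, hε, hlt⟩ := phi_ex cu cr rp cy hc hyint y1 (by
    by_contra! hu0
    obtain ⟨x, hx, hne⟩ := hn
    refine hne ?_
    rw [hyint x hx]
    refine intervalIntegral.integral_zero_ae (Eventually.of_forall fun t ht => hu0 t ?_)
    rw [uIoc_of_le hx.1] at ht
    exact ⟨ht.1.le, ht.2.trans hx.2⟩)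
  set R : ℝ → ℝ := fun x => Real.sqrt (u x ^ 2 + ε ^ 2) with hR
  have cR : Continuous R := by fun_prop
  have hin : ∀ x, 0 < u x ^ 2 + ε ^ 2 := fun x => by positivity
  have Rp : ∀ x, 0 < R x := fun x => Real.sqrt_pos.2 (hin x)
  have Rsq : ∀ x, R x ^ 2 = u x ^ 2 + ε ^ 2 := fun x => Real.sq_sqrt (hin x).le
  have dR : ∀ x ∈ Icc (0:ℝ) 1, HasDerivWithinAt R (u x * (q x / p x) / R x) (Icc 0 1) x := by
    intro x hx
    have := (((hu x hx).pow 2).add_const (ε ^ 2)).sqrt (hin x).ne'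
    refine this.congr_deriv ?_
    have hRx := (Rp x).ne'
    change _ / (2 * R x) = _
    push_cast
    rw [pow_one]
    field_simp
  have hR0 : ∀ x, u x = 0 → R x - ε = 0 := by
    intro x hx
    simp only [hR, hx]
    rw [zero_pow two_ne_zero, zero_add, Real.sqrt_sq hε.le, sub_self]
  have ne : ∀ x, R x ≠ 0 := fun x => (Rp x).ne'
  have pne : ∀ x, p x ≠ 0 := fun x => (h.ppos x).ne'
  have cuR : Continuous fun x => R x - ε := by fun_prop
  have cqe : Continuous fun x => q x * (u x / R x) := cq.mul (cu.div cR ne)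
  have cze : Continuous fun x => z x * (u x / R x) + q x * (((q x / p x) * R x
      - u x * (u x * (q x / p x) / R x)) / R x ^ 2) :=
    (cz.mul (cu.div cR ne)).add (cq.mul (((((cq.div cp pne).mul cR).sub
      (cu.mul ((cu.mul (cq.div cp pne)).div cR ne)))).div (cR.pow 2) fun x => pow_ne_zero 2 (ne x)))
  obtain ⟨G, G1, G2, G3⟩ := h.rep_norm (y := fun x => ∫ t in (0:ℝ)..x, (R t - ε))
    (u := fun x => R x - ε) (q := fun x => q x * (u x / R x)) cuR cqe cze
    (fun x hx => (intervalIntegral.integral_hasDerivAt_right (cuR.intervalIntegrable _ _)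
        (cuR.stronglyMeasurableAtFilter _ _) cuR.continuousAt).hasDerivWithinAt)
    (fun x hx => ((dR x hx).sub_const ε).congr_deriv (by ring))
    (fun x hx => (hq x hx).mul ((hu x hx).div (dR x hx) (ne x)))
    (by simp) (hR0 0 u0) (hR0 1 u1)
  have hK := K_quad hφ cr c α G1 G2
  have hGle : inner ℝ G G ≤ ∫ x in (0:ℝ)..1, q x ^ 2 / p x := by
    rw [G3]
    refine intervalIntegral.integral_mono_on zero_le_one
      (((cqe.pow 2).div cp pne).intervalIntegrable _ _)
      (((cq.pow 2).div cp pne).intervalIntegrable _ _) fun x hx => ?_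
    refine div_le_div_of_nonneg_right ?_ (h.ppos x).le
    rw [mul_pow, div_pow, Rsq]
    refine mul_le_of_le_one_right (sq_nonneg _) ?_
    rw [div_le_one (hin x)]
    nlinarith [sq_nonneg ε]
  have hα2 : 0 ≤ α * (∫ t in (0:ℝ)..1, (R t - ε)) ^ 2 := mul_nonneg hα (sq_nonneg _)
  have hbig : inner ℝ G G < lam * inner ℝ (Kop φ r c α G) G := by
    refine (hGle.trans_eq hen.symm).trans_lt (mul_lt_mul_of_pos_left ?_ hl)
    rw [hK]
    linarith
  have hG0 : G ≠ 0 := by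
    rintro rfl
    simp at hbig
  have hGG : 0 < inner ℝ G G := real_inner_self_pos.2 hG0
  set ρ := inner ℝ (Kop φ r c α G) G / inner ℝ G G with hρ
  have hρl : 1 / lam < ρ := by
    rw [hρ, div_lt_div_iff₀ hl hGG]
    linarith
  have hρ0 : 0 < ρ := (one_div_pos.2 hl).trans hρl
  obtain ⟨w, hw, hw0, ν, hν, hwE⟩ := ev_sub (-(Kop φ r c α)) (K_compact hφ cr c α).neg
    (fun a b => by simp [K_symm hφ cr c α a b]) (VV2 φ) (VV2_closed φ) (-ρ) (by linarith) G
    ((mem_VV2 _ _).2 (by rw [G1 1 (by simp), hR0 1 u1])) hG0 (by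
      rw [neg_apply, inner_neg_left, ← real_inner_self_eq_norm_sq, hρ]
      field_simp
      simp)
  refine ⟨1 / (-ν), one_div_pos.2 (by linarith), ?_, h.se2 cr (by linarith) ⟨hw, hw0, ?_⟩⟩
  · rw [div_lt_comm₀ (by linarith) hl]; linarith
  · intro v hv
    have := hwE v hv
    rw [neg_apply, inner_neg_left] at this
    linarith

end

theorem KRep_exists {p : ℝ → ℝ} (cp : Continuous p) (pp : ∀ x, 0 < p x) :
    ∃ (P : ℝ → ℝ) (φ : ℝ → Lp ℝ 2 (volume : Measure ℝ)), KRep p P φ := by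
  have ci : Continuous fun x => 1 / p x := continuous_const.div cp fun x => (pp x).ne'
  have hd : ∀ x, HasDerivAt (fun x => ∫ t in (0:ℝ)..x, 1 / p t) (1 / p x) x := fun x =>
    intervalIntegral.integral_hasDerivAt_right (ci.intervalIntegrable _ _)
        (ci.stronglyMeasurableAtFilter _ _) ci.continuousAt
  obtain ⟨φ, h1, h2⟩ := exists_phi (fun x => ∫ t in (0:ℝ)..x, 1 / p t)
    (continuous_iff_continuousAt.2 fun x => (hd x).continuousAt)
    (monotone_of_deriv_nonneg (fun x => (hd x).differentiableAt)
      fun x => by rw [(hd x).deriv]; exact (one_div_pos.2 (pp x)).le) (by simp)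
  exact ⟨_, φ, h1, h2, hd, by simp, cp, pp⟩

theorem stmt_19 (p r : ℝ → ℝ) (c alpha : ℝ)
    (hpc : ContinuousOn p (Icc 0 1)) (hrc : ContinuousOn r (Icc 0 1))
    (hp : ∀ x ∈ Icc (0:ℝ) 1, 0 < p x) (hr : ∀ x ∈ Icc (0:ℝ) 1, 0 < r x) :
    (∀ n : ℕ, 1 ≤ n → ∀ lam lam' : ℝ,
      NthNegEig (EigT1 p r c) n lam → NthNegEig (EigT2 p r c alpha) n lam' →
      lam < lam') ∧
    (∀ n : ℕ, 1 ≤ n → ∀ lam nu : ℝ,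
      NthNegEig (EigT1 p r c) n lam → NthNegEig (EigT2 p r c alpha) (n + 1) nu →
      nu < lam) ∧
    (0 < c → 0 ≤ alpha → ∀ lam₁ lam₁' : ℝ,
      0 < lam₁ → EigT1 p r c lam₁ →
      (∀ μ : ℝ, 0 < μ → μ < lam₁ → ¬ EigT1 p r c μ) →
      0 < lam₁' → EigT2 p r c alpha lam₁' →
      (∀ μ : ℝ, 0 < μ → μ < lam₁' → ¬ EigT2 p r c alpha μ) →
      lam₁' < lam₁) := by
  have e1 : EigT1 p r c = SE1 (clx p) (clx r) c :=
    funext fun l => propext (bridge1 c l hpc hrc hp)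
  have e2 : EigT2 p r c alpha = SE2 (clx p) (clx r) c alpha :=
    funext fun l => propext (bridge2 c alpha l hpc hrc hp)
  have rp : ∀ x, 0 < clx r x := fun x => hr _ (clx_mem x)
  have cr := clx_cont hrc
  obtain ⟨P, φ, h⟩ := KRep_exists (clx_cont hpc) fun x => hp _ (clx_mem x)
  rw [e1, e2]
  refine ⟨fun n hn lam lam' h1 h2 => h.part_a cr rp hn h1 h2,
    fun n hn lam nu h1 h2 => h.part_b cr rp hn h1 h2, ?_⟩
  intro hc hα l l' hl hE _ hl' hE' hno
  by_contra! hle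
  obtain ⟨μ, m1, m2, m3⟩ := h.part_c cr rp hc hα hl hE
  exact hno μ m1 (m2.trans_le hle) m3
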